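/- Fix r ≥ 2, an r-critical graph F, and ε > 0. For all sufficiently large n and every integer q with 1 ≤ q < n^{1−ε}, every graph H on n vertices with t_r(n) + q edges either contains a vertex that lies in at least q·c(n,F) copies of F, or contains at least (1−ε)q edges each of which lies in at least (1−ε)·c(n,F) copies of F. -/

import Mathlib

open SimpleGraph Finset

/-- The number of copies of `F` in `H`: edge-preserving injections divided by `Aut(F)`. -/
noncomputable def copyCount {α β : Type*} (F : SimpleGraph α) (H : SimpleGraph β) : ℕ :=
  Nat.card {f : α ↪ β // ∀ ⦃u v⦄, F.Adj u v → H.Adj (f u) (f v)} / Nat.card (F ≃g F)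

/-- `H` contains a copy of `F`. -/
def HasCopy {α β : Type*} (F : SimpleGraph α) (H : SimpleGraph β) : Prop :=
  ∃ f : α ↪ β, ∀ ⦃u v⦄, F.Adj u v → H.Adj (f u) (f v)

/-- `F` is `r`-critical: chromatic number `r+1`, and deleting some edge makes it `r`. -/
def IsCriticalGraph (r : ℕ) {α : Type*} (F : SimpleGraph α) : Prop :=
  F.chromaticNumber = ((r + 1 : ℕ) : ℕ∞) ∧
    ∃ e ∈ F.edgeSet, (F.deleteEdges {e}).chromaticNumber = ((r : ℕ) : ℕ∞)

/-- `t_r(n)`: the number of edges of the Turán graph `T_r(n)`. -/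
noncomputable def turanEdges (r n : ℕ) : ℕ := (SimpleGraph.turanGraph n r).edgeSet.ncard

/-- `c(n,F)`: minimum number of copies of `F` in `T_r(n)` plus one edge inside a part
(the parts of `turanGraph n r` are the residue classes mod `r`). -/
noncomputable def critCount (r n : ℕ) {α : Type*} (F : SimpleGraph α) : ℕ :=
  sInf { m | ∃ u v : Fin n, u ≠ v ∧ (u : ℕ) % r = (v : ℕ) % r ∧
    m = copyCount F (SimpleGraph.turanGraph n r ⊔ SimpleGraph.fromEdgeSet {s(u, v)}) }

/-- The number of copies of `F` in `H` containing the vertex `x`. -/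
noncomputable def copyCountThrough {α β : Type*} (F : SimpleGraph α) (H : SimpleGraph β)
    (x : β) : ℕ :=
  Nat.card {f : α ↪ β // (∀ ⦃u v⦄, F.Adj u v → H.Adj (f u) (f v)) ∧ ∃ u, f u = x} /
    Nat.card (F ≃g F)

/-- The number of copies of `F` in `H` containing the pair `e` as an edge. -/
noncomputable def copyCountOnEdge {α β : Type*} (F : SimpleGraph α) (H : SimpleGraph β)
    (e : Sym2 β) : ℕ :=
  Nat.card {f : α ↪ β // (∀ ⦃u v⦄, F.Adj u v → H.Adj (f u) (f v)) ∧
      ∃ u v, F.Adj u v ∧ s(f u, f v) = e} /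
    Nat.card (F ≃g F)

section
open scoped Classical

theorem card_filter_comp_mul {α κ V : Type*} [Fintype α] [DecidableEq α] [Fintype κ]
    [DecidableEq κ] [Fintype V]
    (s : κ → α) (hs : Function.Injective s) (R : (κ → V) → Prop) :
    #{φ : α → V | R (φ ∘ s)} * Fintype.card V ^ Fintype.card κ =
      #{ρ : κ → V | R ρ} * Fintype.card V ^ Fintype.card α := by
  let e : κ ⊕ ↥(Set.range s)ᶜ ≃ α :=
    (Equiv.sumCongr (Equiv.ofInjective s hs) (Equiv.refl _)).trans
      (Equiv.Set.sumCompl (Set.range s))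
  let E : (α → V) ≃ (κ → V) × (↥(Set.range s)ᶜ → V) :=
    (Equiv.arrowCongr e.symm (Equiv.refl V)).trans (Equiv.sumArrowEquivProdArrow _ _ _)
  have hE : ∀ φ, (E φ).1 = φ ∘ s := by
    intro φ
    ext k
    simp [E, e, Equiv.sumArrowEquivProdArrow]
  have h1 : #{φ : α → V | R (φ ∘ s)} =
      #(({ρ : κ → V | R ρ} : Finset _) ×ˢ (univ : Finset (↥(Set.range s)ᶜ → V))) := by
    refine Finset.card_equiv E fun φ => ?_
    simp [hE]
  have h2 : Fintype.card α = Fintype.card κ + Fintype.card ↥(Set.range s)ᶜ := by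
    rw [← Fintype.card_congr e, Fintype.card_sum]
  rw [h1, card_product, h2, pow_add, card_univ, Fintype.card_fun]
  ring

theorem card_filter_comp_le {α V : Type*} [Fintype α] [Fintype V] [Nonempty V] {k : ℕ}
    (s : Fin k → α) (hs : Function.Injective s) (R : (Fin k → V) → Prop) [DecidablePred R]
    {P : (α → V) → Prop} [DecidablePred P] (hP : ∀ φ, P φ → R (φ ∘ s)) {m : ℝ}
    (hm : (#{ρ : Fin k → V | R ρ} : ℝ) ≤ m) :
    (#{φ : α → V | P φ} : ℝ) ≤
      m / (Fintype.card V : ℝ) ^ k * (Fintype.card V : ℝ) ^ Fintype.card α := by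
  have h := card_filter_comp_mul (V := V) s hs R
  have hn : (0 : ℝ) < Fintype.card V := by exact_mod_cast Fintype.card_pos
  rw [Fintype.card_fin] at h
  have h' : (#{φ : α → V | R (φ ∘ s)} : ℝ) * (Fintype.card V : ℝ) ^ k =
      #{ρ : Fin k → V | R ρ} * (Fintype.card V : ℝ) ^ Fintype.card α := by
    have h3 := congrArg (Nat.cast (R := ℝ)) h
    push_cast at h3
    convert! h3
  have h2 : (#{φ : α → V | P φ} : ℝ) ≤ #{φ : α → V | R (φ ∘ s)} := by
    norm_cast
    exact card_le_card fun φ => by simpa using hP φ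
  rw [div_mul_eq_mul_div, le_div_iff₀ (by positivity)]
  calc _ ≤ (#{φ : α → V | R (φ ∘ s)} : ℝ) * (Fintype.card V : ℝ) ^ k := by gcongr
    _ ≤ _ := by
      rw [h']
      gcongr

section Positions

variable {α V : Type*} [Fintype α] [Fintype V] [Nonempty V]

theorem card_two_values_le {a b : α} (hab : a ≠ b) (x y : V) :
    (#{φ : α → V | φ a = x ∧ φ b = y} : ℝ) ≤
      1 / (Fintype.card V : ℝ) ^ 2 * (Fintype.card V : ℝ) ^ Fintype.card α := by
  refine card_filter_comp_le ![a, b] ?_ (fun ρ => ρ 0 = x ∧ ρ 1 = y) (by simp) ?_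
  · intro i j; fin_cases i <;> fin_cases j <;> simp [hab, hab.symm]
  · norm_cast
    refine card_le_one.2 fun ρ h ρ' h' => ?_
    simp only [mem_filter, mem_univ, true_and] at h h'
    ext i
    fin_cases i <;> simp [h, h']

theorem card_collision_le {a b : α} (hab : a ≠ b) :
    (#{φ : α → V | φ a = φ b} : ℝ) ≤
      Fintype.card V / (Fintype.card V : ℝ) ^ 2 * (Fintype.card V : ℝ) ^ Fintype.card α := by
  refine card_filter_comp_le ![a, b] ?_ (fun ρ => ρ 0 = ρ 1) (by simp) ?_
  · intro i j; fin_cases i <;> fin_cases j <;> simp [hab, hab.symm]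
  · norm_cast
    rw [← card_univ]
    refine card_le_card_of_injOn (fun ρ => ρ 0) (by simp) ?_
    intro ρ h ρ' h' e
    simp only [coe_filter, mem_univ, true_and, Set.mem_ofPred_eq] at h h' e
    ext i
    fin_cases i
    · simpa using e
    · simp [← h, ← h', e]

theorem card_value_rel_le {a w z : α} (hw : w ≠ a) (hz : z ≠ a) (hwz : w ≠ z) (x : V)
    (R : V → V → Prop) :
    (#{φ : α → V | φ a = x ∧ R (φ w) (φ z)} : ℝ) ≤
      #{p : V × V | R p.1 p.2} / (Fintype.card V : ℝ) ^ 3 *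
        (Fintype.card V : ℝ) ^ Fintype.card α := by
  refine card_filter_comp_le ![a, w, z] ?_ (fun ρ => ρ 0 = x ∧ R (ρ 1) (ρ 2)) (by simp) ?_
  · intro i j
    fin_cases i <;> fin_cases j <;> simp [hw, hz, hwz, hw.symm, hz.symm, hwz.symm]
  · norm_cast
    refine card_le_card_of_injOn (fun ρ => (ρ 1, ρ 2)) (fun ρ => by simp) ?_
    intro ρ h ρ' h' e
    simp only [coe_filter, mem_univ, true_and, Set.mem_ofPred_eq, Prod.mk.injEq] at h h' e
    ext i
    fin_cases i <;> simp [h.1, h'.1, e.1, e.2]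

theorem card_two_values_mem_le {a b w : α} (hab : a ≠ b) (ha : w ≠ a) (hb : w ≠ b) (x y : V)
    (S : V → Prop) :
    (#{φ : α → V | φ a = x ∧ φ b = y ∧ S (φ w)} : ℝ) ≤
      #{v : V | S v} / (Fintype.card V : ℝ) ^ 3 * (Fintype.card V : ℝ) ^ Fintype.card α := by
  refine card_filter_comp_le ![a, b, w] ?_ (fun ρ => ρ 0 = x ∧ ρ 1 = y ∧ S (ρ 2)) (by simp) ?_
  · intro i j
    fin_cases i <;> fin_cases j <;> simp [hab, ha, hb, hab.symm, ha.symm, hb.symm]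
  · norm_cast
    refine card_le_card_of_injOn (fun ρ => ρ 2) (fun ρ => by simp) ?_
    intro ρ h ρ' h' e
    simp only [coe_filter, mem_univ, true_and, Set.mem_ofPred_eq] at h h' e
    ext i
    fin_cases i <;> simp [h.1, h'.1, h.2.1, h'.2.1, e]

theorem card_two_values_rel_le {a b w z : α} (hab : a ≠ b) (hwa : w ≠ a) (hwb : w ≠ b)
    (hza : z ≠ a) (hzb : z ≠ b) (hwz : w ≠ z) (x y : V) (R : V → V → Prop) :
    (#{φ : α → V | φ a = x ∧ φ b = y ∧ R (φ w) (φ z)} : ℝ) ≤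
      #{p : V × V | R p.1 p.2} / (Fintype.card V : ℝ) ^ 4 *
        (Fintype.card V : ℝ) ^ Fintype.card α := by
  refine card_filter_comp_le ![a, b, w, z] ?_
    (fun ρ => ρ 0 = x ∧ ρ 1 = y ∧ R (ρ 2) (ρ 3)) (by simp) ?_
  · intro i j
    fin_cases i <;> fin_cases j <;> simp [hab, hab.symm, hwa, hwb, hza, hzb, hwz, hwa.symm,
      hwb.symm, hza.symm, hzb.symm, hwz.symm]
  · norm_cast
    refine card_le_card_of_injOn (fun ρ => (ρ 2, ρ 3)) (fun ρ => by simp) ?_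
    intro ρ h ρ' h' e
    simp only [coe_filter, mem_univ, true_and, Set.mem_ofPred_eq, Prod.mk.injEq] at h h' e
    ext i
    fin_cases i <;> simp [h.1, h'.1, h.2.1, h'.2.1, e.1, e.2]

omit [Nonempty V] in
/-- A union bound over ordered pairs of vertices of `α`. -/
theorem card_exists_pair_le (Q : α → α → (α → V) → Prop) {c : ℝ}
    (h : ∀ w z, (#{φ : α → V | Q w z φ} : ℝ) ≤ c) :
    (#{φ : α → V | ∃ w z, Q w z φ} : ℝ) ≤ (Fintype.card α : ℝ) ^ 2 * c := by
  have hsub : ({φ : α → V | ∃ w z, Q w z φ} : Finset _) ⊆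
      (univ : Finset (α × α)).biUnion fun p => {φ : α → V | Q p.1 p.2 φ} := by
    intro φ
    simp
  have h1 := (card_le_card hsub).trans card_biUnion_le
  calc (#{φ : α → V | ∃ w z, Q w z φ} : ℝ)
      ≤ ∑ p : α × α, (#{φ : α → V | Q p.1 p.2 φ} : ℝ) := by exact_mod_cast h1
    _ ≤ ∑ _p : α × α, c := sum_le_sum fun p _ => h _ _
    _ = (Fintype.card α : ℝ) ^ 2 * c := by
        simp [sq]

theorem card_not_injective_le :
    (#{φ : α → V | ¬ Function.Injective φ} : ℝ) ≤
      (Fintype.card α : ℝ) ^ 2 * (Fintype.card V / (Fintype.card V : ℝ) ^ 2 *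
        (Fintype.card V : ℝ) ^ Fintype.card α) := by
  refine le_trans ?_ (card_exists_pair_le (fun w z (φ : α → V) => w ≠ z ∧ φ w = φ z) fun w z => ?_)
  · norm_cast
    refine card_le_card fun φ h => mem_filter.2 ⟨mem_univ _, ?_⟩
    have h := (mem_filter.1 h).2
    rw [Function.not_injective_iff] at h
    obtain ⟨w, z, h1, h2⟩ := h
    exact ⟨w, z, h2, h1⟩
  · by_cases hwz : w = z
    · simp only [hwz, ne_eq, not_true_eq_false, false_and, filter_false, card_empty, Nat.cast_zero]
      positivity
    · simpa [hwz] using card_collision_le (V := V) hwz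

theorem card_value_exists_rel_le (a : α) (x : V) (R : V → V → Prop) :
    (#{φ : α → V | φ a = x ∧ ∃ w z, w ≠ a ∧ z ≠ a ∧ w ≠ z ∧ R (φ w) (φ z)} : ℝ) ≤
      (Fintype.card α : ℝ) ^ 2 * (#{p : V × V | R p.1 p.2} / (Fintype.card V : ℝ) ^ 3 *
        (Fintype.card V : ℝ) ^ Fintype.card α) := by
  refine le_trans ?_ (card_exists_pair_le
    (fun w z (φ : α → V) => φ a = x ∧ w ≠ a ∧ z ≠ a ∧ w ≠ z ∧ R (φ w) (φ z)) fun w z => ?_)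
  · norm_cast
    refine card_le_card fun φ => ?_
    simp only [mem_filter, mem_univ, true_and]
    rintro ⟨h, w, z, h'⟩
    exact ⟨w, z, h, h'⟩
  · by_cases hc : w ≠ a ∧ z ≠ a ∧ w ≠ z
    · simpa [hc] using card_value_rel_le hc.1 hc.2.1 hc.2.2 x R
    · have : ∀ φ : α → V, ¬ (φ a = x ∧ w ≠ a ∧ z ≠ a ∧ w ≠ z ∧ R (φ w) (φ z)) := by tauto
      simp only [this, filter_false, card_empty, Nat.cast_zero]
      positivity

theorem card_two_values_exists_rel_le {a b : α} (hab : a ≠ b) (x y : V) (R : V → V → Prop)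
    (hR : ∀ v w, R v w → R w v) {d m : ℝ} (hx : (#{v : V | R x v} : ℝ) ≤ d)
    (hy : (#{v : V | R y v} : ℝ) ≤ d) (hm : (#{p : V × V | R p.1 p.2} : ℝ) ≤ m) :
    (#{φ : α → V | φ a = x ∧ φ b = y ∧
        ∃ w z, w ≠ z ∧ s(w, z) ≠ s(a, b) ∧ R (φ w) (φ z)} : ℝ) ≤
      (Fintype.card α : ℝ) ^ 2 * ((d / (Fintype.card V : ℝ) ^ 3 + m / (Fintype.card V : ℝ) ^ 4) *
        (Fintype.card V : ℝ) ^ Fintype.card α) := by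
  have hd0 : 0 ≤ d := le_trans (by positivity) hx
  have hm0 : 0 ≤ m := le_trans (by positivity) hm
  have hn : (0 : ℝ) < Fintype.card V := by exact_mod_cast Fintype.card_pos
  set N : ℝ := (Fintype.card V : ℝ)
  set M := N ^ Fintype.card α
  have hM : 0 ≤ M := by positivity
  have hdN : d / N ^ 3 * M ≤ (d / N ^ 3 + m / N ^ 4) * M := by
    gcongr
    have : 0 ≤ m / N ^ 4 := by positivity
    linarith
  have hmN : m / N ^ 4 * M ≤ (d / N ^ 3 + m / N ^ 4) * M := by
    gcongr
    have : 0 ≤ d / N ^ 3 := by positivity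
    linarith
  have key : ∀ (w : α) (v : V), w ≠ a → w ≠ b → (#{u : V | R v u} : ℝ) ≤ d →
      ∀ P : (α → V) → Prop, (∀ φ, P φ → φ a = x ∧ φ b = y ∧ R v (φ w)) →
      (#{φ : α → V | P φ} : ℝ) ≤ (d / N ^ 3 + m / N ^ 4) * M := by
    intro w v hwa hwb hv P hP
    have h1 : (#{φ : α → V | P φ} : ℝ) ≤ #{φ : α → V | φ a = x ∧ φ b = y ∧ R v (φ w)} := by
      norm_cast
      exact card_le_card fun φ => by simpa using hP φ
    refine h1.trans ((card_two_values_mem_le hab hwa hwb x y (R v)).trans (le_trans ?_ hdN))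
    gcongr
  refine le_trans ?_ (card_exists_pair_le
    (fun w z (φ : α → V) => φ a = x ∧ φ b = y ∧ w ≠ z ∧ s(w, z) ≠ s(a, b) ∧ R (φ w) (φ z)) fun w z => ?_)
  · norm_cast
    refine card_le_card fun φ => ?_
    simp only [mem_filter, mem_univ, true_and]
    rintro ⟨h, h'', w, z, h'⟩
    exact ⟨w, z, h, h'', h'⟩
  · by_cases hc : w ≠ z ∧ s(w, z) ≠ s(a, b)
    swap
    · have : ∀ φ : α → V, ¬ (φ a = x ∧ φ b = y ∧ w ≠ z ∧ s(w, z) ≠ s(a, b) ∧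
        R (φ w) (φ z)) := by tauto
      simp only [this, filter_false, card_empty, Nat.cast_zero]
      positivity
    obtain ⟨hwz, hs⟩ := hc
    have hs' : ¬ (w = a ∧ z = b) ∧ ¬ (w = b ∧ z = a) := by
      constructor
      · rintro ⟨rfl, rfl⟩; exact hs rfl
      · rintro ⟨rfl, rfl⟩; exact hs Sym2.eq_swap
    by_cases hwa : w = a
    · subst hwa
      exact key z x hwz.symm (by tauto) hx _ fun φ h => ⟨h.1, h.2.1, h.1 ▸ h.2.2.2.2⟩
    by_cases hwb : w = b
    · subst hwb
      exact key z y (by tauto) hwz.symm hy _ fun φ h => ⟨h.1, h.2.1, h.2.1 ▸ h.2.2.2.2⟩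
    by_cases hza : z = a
    · subst hza
      exact key w x hwa hwb hx _ fun φ h => ⟨h.1, h.2.1, h.1 ▸ hR _ _ h.2.2.2.2⟩
    by_cases hzb : z = b
    · subst hzb
      exact key w y hwa hwb hy _ fun φ h => ⟨h.1, h.2.1, h.2.1 ▸ hR _ _ h.2.2.2.2⟩
    simp only [ne_eq, hwz, hs, not_false_eq_true, true_and]
    refine (card_two_values_rel_le hab hwa hwb hza hzb hwz x y R).trans (le_trans ?_ hmN)
    gcongr

end Positions

section Density

/-- The proportion of elements of a finite type satisfying a predicate. -/
noncomputable def density {X : Type} [Fintype X] (P : X → Prop) : ℝ :=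
  #{x | P x} / Fintype.card X

theorem density_congr {X Y : Type} [Fintype X] [Fintype Y] (e : X ≃ Y) {P : X → Prop}
    {Q : Y → Prop} (h : ∀ x, P x ↔ Q (e x)) : density P = density Q := by
  have h1 : #{x | P x} = #{y | Q y} := Finset.card_equiv e fun x => by simp [h]
  rw [density, density, h1, Fintype.card_congr e]

theorem density_nonneg {X : Type} [Fintype X] (P : X → Prop) : 0 ≤ density P := by
  unfold density
  positivity

theorem density_mono {X : Type} [Fintype X] {P Q : X → Prop} (h : ∀ x, P x → Q x) :
    density P ≤ density Q := by
  have h1 : #{x | P x} ≤ #{x | Q x} := card_le_card fun x => by simpa using h x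
  unfold density
  gcongr

theorem density_comp {α κ V : Type} [Fintype α] [DecidableEq α] [Fintype κ] [DecidableEq κ]
    [Fintype V] [Nonempty V]
    (s : κ → α) (hs : Function.Injective s) (R : (κ → V) → Prop) :
    density (fun φ : α → V => R (φ ∘ s)) = density R := by
  have h := congrArg (Nat.cast (R := ℝ)) (card_filter_comp_mul (V := V) s hs R)
  push_cast at h
  have hn : (Fintype.card V : ℝ) ≠ 0 := by exact_mod_cast Fintype.card_ne_zero
  rw [density, density, Fintype.card_fun, Fintype.card_fun]
  push_cast
  rw [div_eq_div_iff (by positivity) (by positivity)]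
  convert! h

theorem density_pow_le {V X : Type} [Fintype V] [Fintype X] [Nonempty V] [Nonempty X]
    (α : Type) [Fintype α] (W : V × X → Prop) :
    density W ^ Fintype.card α ≤ density fun p : (α → V) × X => ∀ a, W (p.1 a, p.2) := by
  have hV : (0 : ℝ) < Fintype.card V := by exact_mod_cast Fintype.card_pos
  have hX : (0 : ℝ) < Fintype.card X := by exact_mod_cast Fintype.card_pos
  have h1 : #{p : V × X | W p} = ∑ x, #{v : V | W (v, x)} := by
    rw [Finset.card_eq_sum_card_fiberwise (f := Prod.snd) (t := univ) (by simp)]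
    refine sum_congr rfl fun x _ => ?_
    refine card_bij' (fun p _ => p.1) (fun v _ => (v, x)) ?_ ?_ ?_ ?_ <;> simp
    · rintro a b h rfl; exact h
    · rintro a b h rfl; rfl
  have h2 : #{p : (α → V) × X | ∀ a, W (p.1 a, p.2)} =
      ∑ x, #{v : V | W (v, x)} ^ Fintype.card α := by
    rw [Finset.card_eq_sum_card_fiberwise (f := Prod.snd) (t := univ) (by simp)]
    refine sum_congr rfl fun x _ => ?_
    rw [← card_univ, ← prod_const, ← Fintype.card_piFinset]
    refine card_bij' (fun p _ => p.1) (fun v _ => (v, x)) ?_ ?_ ?_ ?_ <;> simp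
    · rintro a b h rfl; exact h
    · rintro a b h rfl; rfl
  have h3 := Real.pow_arith_mean_le_arith_mean_pow (univ : Finset X)
    (fun _ => 1 / (Fintype.card X : ℝ))
    (fun x => (#{v : V | W (v, x)} : ℝ) / Fintype.card V) (fun _ _ => by positivity)
    (by simp [hX.ne']) (fun _ _ => by positivity) (Fintype.card α)
  rw [← mul_sum, ← mul_sum] at h3
  simp only [div_pow] at h3
  rw [← sum_div, ← sum_div] at h3
  have e : density (fun p : (α → V) × X => ∀ a, W (p.1 a, p.2)) =
      (#{p : (α → V) × X | ∀ a, W (p.1 a, p.2)} : ℝ) / Fintype.card ((α → V) × X) := by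
    rw [density]
    congr!
  rw [e, density, h1, h2, Fintype.card_prod, Fintype.card_prod, Fintype.card_fun]
  push_cast
  rw [one_div_mul_eq_div, one_div_mul_eq_div, div_div, div_div] at h3
  exact h3

theorem density_pow_pow_le {V : Type} [Fintype V] [Nonempty V] (α : Type) [Fintype α] :
    ∀ (k : ℕ) {X : Type} [Fintype X] [Nonempty X] (W : (Fin k → V) × X → Prop),
      density W ^ Fintype.card α ^ k ≤
        density fun p : (Fin k → α → V) × X => ∀ s : Fin k → α, W (fun i => p.1 i (s i), p.2) := by
  intro k
  induction k with
  | zero =>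
    intro X _ _ W
    rw [pow_zero, pow_one]
    refine (density_congr (Equiv.prodCongr (Equiv.ofUnique _ _) (Equiv.refl X)) ?_).le
    rintro ⟨t, x⟩
    have ht : ∀ u : Fin 0 → V, u = t := fun u => Subsingleton.elim _ _
    simp [ht]
  | succ k ih =>
    intro X _ _ W
    have e1 : density W = density fun p : V × ((Fin k → V) × X) =>
        W (Fin.cons p.1 p.2.1, p.2.2) := by
      refine (density_congr ((Equiv.prodAssoc _ _ _).symm.trans
        (Equiv.prodCongr (Fin.consEquiv fun _ : Fin (k + 1) => V) (Equiv.refl X))) ?_).symm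
      rintro ⟨v, t, x⟩
      rfl
    have e2 : density (fun p : (α → V) × ((Fin k → V) × X) =>
        ∀ a, W (Fin.cons (p.1 a) p.2.1, p.2.2)) =
        density fun p : (Fin k → V) × ((α → V) × X) =>
        ∀ a, W (Fin.cons (p.2.1 a) p.1, p.2.2) := by
      refine density_congr ((Equiv.prodAssoc _ _ _).symm.trans
        ((Equiv.prodCongr (Equiv.prodComm _ _) (Equiv.refl X)).trans (Equiv.prodAssoc _ _ _))) ?_
      rintro ⟨v, t, x⟩
      rfl
    have h1 := density_pow_le α fun p : V × ((Fin k → V) × X) => W (Fin.cons p.1 p.2.1, p.2.2)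
    have h2 := ih fun p : (Fin k → V) × ((α → V) × X) => ∀ a, W (Fin.cons (p.2.1 a) p.1, p.2.2)
    rw [e1, pow_succ', pow_mul]
    refine (pow_le_pow_left₀ (pow_nonneg (density_nonneg _) _) h1 _).trans ?_
    dsimp only
    rw [e2]
    refine h2.trans (density_congr ((Equiv.prodAssoc _ _ _).symm.trans (Equiv.prodCongr
      ((Equiv.prodComm _ _).trans (Fin.consEquiv fun _ : Fin (k + 1) => α → V))
      (Equiv.refl X))) ?_).le
    rintro ⟨Φ, ψ, x⟩
    dsimp [Fin.consEquiv]
    constructor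
    · intro h s
      convert! h (Fin.tail s) (s 0) using 2
      ext i
      refine Fin.cases ?_ (fun i => ?_) i <;> simp [Fin.tail]
    · intro h s a
      convert! h (Fin.cons a s) using 2
      ext i
      refine Fin.cases ?_ (fun i => ?_) i <;> simp

/-- Supersaturation of homomorphisms from a `k`-colourable graph in terms of ordered
`k`-cliques. -/
theorem density_clique_pow_le_density_hom {α V : Type} [Fintype α] [Fintype V] [Nonempty V]
    {k : ℕ} (F : SimpleGraph α) (χ : F.Coloring (Fin k)) (H : SimpleGraph V) :
    density (fun t : Fin k → V => ∀ i j, i ≠ j → H.Adj (t i) (t j)) ^ Fintype.card α ^ k ≤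
      density fun φ : α → V => ∀ ⦃u v⦄, F.Adj u v → H.Adj (φ u) (φ v) := by
  have h := density_pow_pow_le (V := V) α k (X := Unit)
    fun p => ∀ i j, i ≠ j → H.Adj (p.1 i) (p.1 j)
  have e1 : density (fun t : Fin k → V => ∀ i j, i ≠ j → H.Adj (t i) (t j)) =
      density fun p : (Fin k → V) × Unit => ∀ i j, i ≠ j → H.Adj (p.1 i) (p.1 j) :=
    density_congr (Equiv.prodPUnit _).symm fun t => Iff.rfl
  have e2 := density_comp (V := V) (fun a : α => (χ a, a))
    (fun a b hab => (Prod.ext_iff.1 hab).2)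
    fun φ => ∀ ⦃u v⦄, F.Adj u v → H.Adj (φ u) (φ v)
  have e3 : density (fun p : (Fin k → α → V) × Unit => ∀ s : Fin k → α, ∀ i j, i ≠ j →
      H.Adj (p.1 i (s i)) (p.1 j (s j))) = density fun φ : Fin k × α → V =>
        ∀ s : Fin k → α, ∀ i j, i ≠ j → H.Adj (φ (i, s i)) (φ (j, s j)) :=
    density_congr ((Equiv.prodPUnit _).trans (Equiv.curry (Fin k) α V).symm) fun p => Iff.rfl
  rw [e1, ← e2]
  refine h.trans (e3.trans_le ?_)
  refine density_mono fun φ hφ => ?_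
  intro u v huv
  have hχ : χ u ≠ χ v := χ.valid huv
  change H.Adj (φ (χ u, u)) (φ (χ v, v))
  have h1 := hφ (fun i => if i = χ v then v else u) (χ u) (χ v) hχ
  rw [if_neg hχ, if_pos rfl] at h1
  exact h1

end Density

section Stability

variable {V : Type} [Fintype V] (G : SimpleGraph V)

/-- The ordered `s`-cliques of a graph. -/
noncomputable def orderedCliques (s : ℕ) : Finset (Fin s → V) :=
  {t | ∀ i j, i ≠ j → G.Adj (t i) (t j)}

/-- The common neighbours of a tuple of vertices. -/
noncomputable def commonNbrs {s : ℕ} (t : Fin s → V) : Finset V :=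
  {x | ∀ i, G.Adj (t i) x}

/-- The vertices which remain outside the common neighbourhood of a tuple whichever single entry
of the tuple is deleted. -/
noncomputable def farVertices {s : ℕ} (K : Fin (s + 1) → V) : Finset V :=
  {x | ∀ i : Fin (s + 1), x ∉ commonNbrs G (K ∘ i.succAbove)}

theorem mem_orderedCliques {s : ℕ} {t : Fin s → V} :
    t ∈ orderedCliques G s ↔ ∀ i j, i ≠ j → G.Adj (t i) (t j) := by
  simp [orderedCliques]

theorem mem_commonNbrs {s : ℕ} {t : Fin s → V} {x : V} :
    x ∈ commonNbrs G t ↔ ∀ i, G.Adj (t i) x := by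
  simp [commonNbrs]

theorem mem_farVertices {s : ℕ} {K : Fin (s + 1) → V} {x : V} :
    x ∈ farVertices G K ↔ ∀ i : Fin (s + 1), x ∉ commonNbrs G (K ∘ i.succAbove) := by
  simp [farVertices]

theorem insertNth_mem_orderedCliques {s : ℕ} (i : Fin (s + 1)) (x : V) (k : Fin s → V) :
    (i.insertNth x k : Fin (s + 1) → V) ∈ orderedCliques G (s + 1) ↔
      k ∈ orderedCliques G s ∧ x ∈ commonNbrs G k := by
  simp only [mem_orderedCliques, mem_commonNbrs]
  constructor
  · intro h
    refine ⟨fun a b hab => ?_, fun a => ?_⟩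
    · simpa using h (i.succAbove a) (i.succAbove b) (by simpa using hab)
    · simpa using h (i.succAbove a) i (Fin.succAbove_ne i a)
  · rintro ⟨h1, h2⟩ a b hab
    rcases Fin.eq_self_or_eq_succAbove i a with ha | ⟨a, rfl⟩ <;>
      rcases Fin.eq_self_or_eq_succAbove i b with hb | ⟨b, rfl⟩
    · exact absurd (ha.trans hb.symm) hab
    · rw [ha]
      simpa using (h2 b).symm
    · rw [hb]
      simpa using h2 a
    · simpa using h1 a b (by simpa using hab)

theorem sum_orderedCliques_succ {s : ℕ} (i : Fin (s + 1)) (g : (Fin s → V) → V → ℝ) :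
    ∑ K ∈ orderedCliques G (s + 1), g (K ∘ i.succAbove) (K i) =
      ∑ k ∈ orderedCliques G s, ∑ x ∈ commonNbrs G k, g k x := by
  rw [Finset.sum_sigma']
  refine Finset.sum_bij' (fun K _ => ⟨K ∘ i.succAbove, K i⟩)
    (fun p _ => i.insertNth p.2 p.1) ?_ ?_ ?_ ?_ ?_
  · intro K hK
    rw [← Fin.insertNth_self_removeNth i K, insertNth_mem_orderedCliques] at hK
    exact mem_sigma.2 hK
  · rintro ⟨k, x⟩ h
    simpa [insertNth_mem_orderedCliques] using h
  · intro K _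
    exact Fin.insertNth_self_removeNth i K
  · rintro ⟨k, x⟩ _
    simp [Function.comp_def]
  · intro K _
    rfl

theorem card_orderedCliques_succ (s : ℕ) :
    (#(orderedCliques G (s + 1)) : ℝ) = ∑ k ∈ orderedCliques G s, (#(commonNbrs G k) : ℝ) := by
  have h := sum_orderedCliques_succ G (s := s) 0 (fun _ _ => 1)
  simpa using h

theorem sum_card_commonNbrs_add_le {s : ℕ} (K : Fin (s + 1) → V) :
    ∑ i : Fin (s + 1), (#(commonNbrs G (K ∘ i.succAbove)) : ℝ) + #(farVertices G K) ≤
      Fintype.card V + s * #(commonNbrs G K) := by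
  have h1 : ∀ S : Finset V, (#S : ℝ) = ∑ x : V, if x ∈ S then (1 : ℝ) else 0 := by
    intro S
    simp
  have h2 : (Fintype.card V : ℝ) = ∑ _x : V, (1 : ℝ) := by simp
  simp only [h1, h2]
  rw [sum_comm, ← sum_add_distrib, mul_sum, ← sum_add_distrib]
  refine sum_le_sum fun x _ => ?_
  by_cases hx : x ∈ commonNbrs G K
  · have h3 : x ∉ farVertices G K := by
      rw [mem_farVertices]
      intro h
      exact h 0 ((mem_commonNbrs G).2 fun j => (mem_commonNbrs G).1 hx _)
    have h4 : ∑ i : Fin (s + 1), (if x ∈ commonNbrs G (K ∘ i.succAbove) then (1 : ℝ) else 0) ≤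
        ∑ i : Fin (s + 1), (1 : ℝ) := sum_le_sum fun i _ => by split_ifs <;> norm_num
    rw [sum_const, card_univ, Fintype.card_fin, nsmul_eq_mul, mul_one] at h4
    push_cast at h4
    rw [if_pos hx, if_neg h3]
    linarith
  · rw [if_neg hx, mul_zero, add_zero]
    by_cases hf : x ∈ farVertices G K
    · rw [if_pos hf, sum_eq_zero, zero_add]
      intro i _
      rw [if_neg ((mem_farVertices G).1 hf i)]
    · rw [if_neg hf, add_zero]
      have h5 : ∃ i : Fin (s + 1), x ∈ commonNbrs G (K ∘ i.succAbove) := by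
        rw [mem_farVertices] at hf
        push Not at hf
        exact hf
      obtain ⟨i, hi⟩ := h5
      rw [sum_eq_single i]
      · split_ifs
        norm_num
      · intro j _ hji
        rw [if_neg]
        intro hj
        apply hx
        rw [mem_commonNbrs] at hi hj ⊢
        intro l
        rcases Fin.eq_self_or_eq_succAbove i l with rfl | ⟨l, rfl⟩
        · obtain ⟨m, hm⟩ := Fin.exists_succAbove_eq hji.symm
          have := hj m
          rwa [Function.comp_apply, hm] at this
        · exact hi l
      · simp

/-- A Moon–Moser type inequality keeping track of the far vertices. -/
theorem moon_moser_farVertices (s : ℕ) :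
    (s + 1) * (#(orderedCliques G (s + 1)) : ℝ) ^ 2 +
        #(orderedCliques G s) * ∑ K ∈ orderedCliques G (s + 1), (#(farVertices G K) : ℝ) ≤
      #(orderedCliques G s) * (Fintype.card V * #(orderedCliques G (s + 1)) +
        s * #(orderedCliques G (s + 2))) := by
  have h1 : (#(orderedCliques G (s + 1)) : ℝ) ^ 2 ≤ #(orderedCliques G s) *
      ∑ k ∈ orderedCliques G s, (#(commonNbrs G k) : ℝ) ^ 2 := by
    rw [card_orderedCliques_succ]
    exact sq_sum_le_card_mul_sum_sq
  have h2 : ∀ i : Fin (s + 1), ∑ K ∈ orderedCliques G (s + 1),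
      (#(commonNbrs G (K ∘ i.succAbove)) : ℝ) =
      ∑ k ∈ orderedCliques G s, (#(commonNbrs G k) : ℝ) ^ 2 := by
    intro i
    rw [sum_orderedCliques_succ G i fun k _ => (#(commonNbrs G k) : ℝ)]
    refine sum_congr rfl fun k _ => ?_
    rw [sum_const, nsmul_eq_mul, sq]
  have h3 := sum_le_sum fun K (_ : K ∈ orderedCliques G (s + 1)) => sum_card_commonNbrs_add_le G K
  rw [sum_add_distrib, sum_comm, sum_congr rfl fun i _ => h2 i, sum_add_distrib, ← mul_sum,
    ← card_orderedCliques_succ, sum_const, sum_const, card_univ, Fintype.card_fin] at h3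
  simp only [nsmul_eq_mul] at h3
  push_cast at h3
  have h4 : (0 : ℝ) ≤ #(orderedCliques G s) := by positivity
  have h5 := mul_le_mul_of_nonneg_left h3 h4
  have h6 : (0 : ℝ) ≤ s + 1 := by positivity
  have h7 := mul_le_mul_of_nonneg_left h1 h6
  nlinarith [h5, h7]

theorem card_orderedCliques_zero : #(orderedCliques G 0) = 1 := by
  simp [orderedCliques]

theorem card_orderedCliques_one : #(orderedCliques G 1) = Fintype.card V := by
  have : orderedCliques G 1 = univ := by
    ext t
    simp only [mem_orderedCliques, mem_univ, iff_true]
    intro i j h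
    exact absurd (Subsingleton.elim i j) h
  rw [this, card_univ]
  simp

theorem card_orderedCliques_two :
    #(orderedCliques G 2) = #{p : V × V | G.Adj p.1 p.2} := by
  refine Finset.card_equiv (finTwoArrowEquiv V) fun t => ?_
  rw [mem_orderedCliques]
  simp only [Fin.forall_fin_two, finTwoArrowEquiv_apply, mem_filter, mem_univ, true_and]
  constructor
  · intro h; exact h.1.2 (by decide)
  · intro h; exact ⟨⟨by simp, fun _ => h⟩, ⟨fun _ => h.symm, by simp⟩⟩

theorem one_sub_mul_ge {r s : ℕ} {δ : ℝ} (hδr : δ ≤ 1 / (2 * (r : ℝ) ^ 2)) (hs : s + 1 ≤ r) :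
    1 / (2 * (r : ℝ)) ≤ 1 - s * (1 / (r : ℝ) + δ) := by
  have hs' : (s : ℝ) + 1 ≤ r := by exact_mod_cast hs
  have h0 : (0 : ℝ) ≤ s := by positivity
  have hr0 : (0 : ℝ) < r := by linarith
  have h3 : (s : ℝ) * (1 / (r : ℝ) + δ) ≤ (r - 1) * (1 / (r : ℝ) + 1 / (2 * (r : ℝ) ^ 2)) := by
    calc (s : ℝ) * (1 / (r : ℝ) + δ) ≤ s * (1 / (r : ℝ) + 1 / (2 * (r : ℝ) ^ 2)) := by gcongr
      _ ≤ _ := by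
        gcongr
        linarith
  have h4 : (r - 1) * (1 / (r : ℝ) + 1 / (2 * (r : ℝ) ^ 2)) + 1 / (2 * (r : ℝ)) =
      1 - 1 / (2 * (r : ℝ) ^ 2) := by
    have hy : (r : ℝ) * (r : ℝ)⁻¹ = 1 := mul_inv_cancel₀ hr0.ne'
    have e1 : 1 / (2 * (r : ℝ) ^ 2) = (r : ℝ)⁻¹ ^ 2 / 2 := by
      rw [inv_pow, one_div, mul_inv]
      ring
    have e2 : 1 / (2 * (r : ℝ)) = (r : ℝ)⁻¹ / 2 := by
      rw [one_div, mul_inv]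
      ring
    rw [e1, e2, one_div]
    linear_combination (1 + (r : ℝ)⁻¹ / 2) * hy
  have h5 : 0 ≤ 1 / (2 * (r : ℝ) ^ 2) := by positivity
  linarith

theorem orderedCliques_ratio {r : ℕ} {δ : ℝ} [Nonempty V] (hr : 2 ≤ r)
    (hδr : δ ≤ 1 / (2 * (r : ℝ) ^ 2))
    (hG : (1 - 1 / (r : ℝ) - δ) * (Fintype.card V : ℝ) ^ 2 ≤ #{p : V × V | G.Adj p.1 p.2}) :
    ∀ s, 1 ≤ s → s + 1 ≤ r → (0 : ℝ) < #(orderedCliques G s) ∧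
      (1 - s * (1 / (r : ℝ) + δ)) * (Fintype.card V * #(orderedCliques G s)) ≤
        #(orderedCliques G (s + 1)) := by
  have hn : (0 : ℝ) < Fintype.card V := by exact_mod_cast Fintype.card_pos
  have hr0 : (2 : ℝ) ≤ r := by exact_mod_cast hr
  have ha : ∀ s : ℕ, s + 1 ≤ r → 0 < 1 - s * (1 / (r : ℝ) + δ) := fun s hs =>
    lt_of_lt_of_le (by positivity) (one_sub_mul_ge hδr hs)
  intro s hs
  induction s, hs using Nat.le_induction with
  | base =>
    intro _
    rw [card_orderedCliques_one, card_orderedCliques_two]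
    refine ⟨hn, ?_⟩
    convert! hG using 1
    push_cast
    ring
  | succ s hs ih =>
    intro hsr
    obtain ⟨h1, h2⟩ := ih (by omega)
    have h3 : (0 : ℝ) < #(orderedCliques G (s + 1)) :=
      lt_of_lt_of_le (mul_pos (ha s (by omega)) (mul_pos hn h1)) h2
    refine ⟨h3, ?_⟩
    have h4 := moon_moser_farVertices G s
    have h5 : (0 : ℝ) ≤ ∑ K ∈ orderedCliques G (s + 1), (#(farVertices G K) : ℝ) :=
      sum_nonneg fun _ _ => Nat.cast_nonneg _
    have hs0 : (0 : ℝ) < s := by exact_mod_cast hs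
    set A : ℝ := (#(orderedCliques G s) : ℝ)
    set B : ℝ := (#(orderedCliques G (s + 1)) : ℝ)
    set C : ℝ := (#(orderedCliques G (s + 1 + 1)) : ℝ)
    set n : ℝ := (Fintype.card V : ℝ)
    have h6 : A * ((s + 1) * ((1 - s * (1 / (r : ℝ) + δ)) * n * B)) ≤ A * (n * B + s * C) := by
      have : (s + 1) * (((1 - s * (1 / (r : ℝ) + δ)) * (n * A)) * B) ≤ (s + 1) * (B * B) := by
        gcongr
      nlinarith [mul_nonneg h1.le h5]
    have h7 := le_of_mul_le_mul_left h6 h1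
    have h8 : s * ((1 - (s + 1) * (1 / (r : ℝ) + δ)) * (n * B)) ≤ s * C := by
      linarith
    have h9 := le_of_mul_le_mul_left h8 hs0
    push_cast
    exact h9

theorem card_orderedCliques_lower {r : ℕ} {δ : ℝ} [Nonempty V] (hr : 2 ≤ r)
    (hδr : δ ≤ 1 / (2 * (r : ℝ) ^ 2))
    (hG : (1 - 1 / (r : ℝ) - δ) * (Fintype.card V : ℝ) ^ 2 ≤ #{p : V × V | G.Adj p.1 p.2}) :
    ∀ s, s ≤ r → ((Fintype.card V : ℝ) / (2 * r)) ^ s ≤ #(orderedCliques G s) := by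
  have hr0 : (2 : ℝ) ≤ r := by exact_mod_cast hr
  intro s
  induction s with
  | zero => intro _; simp [card_orderedCliques_zero]
  | succ s ih =>
    intro hs
    have ih := ih (by omega)
    rcases Nat.eq_zero_or_pos s with rfl | h0
    · rw [zero_add, card_orderedCliques_one, pow_one]
      exact div_le_self (by positivity) (by linarith)
    · have h1 := (orderedCliques_ratio G hr hδr hG s h0 hs).2
      have h2 : 1 / (2 * (r : ℝ)) ≤ 1 - s * (1 / (r : ℝ) + δ) := one_sub_mul_ge hδr hs
      calc ((Fintype.card V : ℝ) / (2 * r)) ^ (s + 1)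
          = 1 / (2 * (r : ℝ)) * (Fintype.card V * ((Fintype.card V : ℝ) / (2 * r)) ^ s) := by
            rw [pow_succ]; ring
        _ ≤ (1 - s * (1 / (r : ℝ) + δ)) * (Fintype.card V * #(orderedCliques G s)) := by
            gcongr
            exact le_trans (by positivity) h2
        _ ≤ _ := h1

/-- The colouring of the vertices induced by a tuple: `x` gets colour `i` if all entries other
than the `i`-th are adjacent to `x`. -/
noncomputable def tupleColouring {s : ℕ} (K : Fin (s + 1) → V) (x : V) : Fin (s + 1) :=
  if h : ∃ i : Fin (s + 1), x ∈ commonNbrs G (K ∘ i.succAbove) then h.choose else 0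

/-- The ordered adjacent pairs of vertices with the same colour. -/
noncomputable def badPairs {ι : Type} (p : V → ι) : Finset (V × V) :=
  {e | G.Adj e.1 e.2 ∧ p e.1 = p e.2}

theorem card_badPairs_tupleColouring_le {s : ℕ} (K : Fin (s + 1) → V) :
    (#(badPairs G (tupleColouring G K)) : ℝ) ≤ 2 * Fintype.card V * #(farVertices G K) +
      ∑ i : Fin (s + 1), ∑ x ∈ commonNbrs G (K ∘ i.succAbove),
        (#{y ∈ commonNbrs G (K ∘ i.succAbove) | G.Adj x y} : ℝ) := by
  have hsub : badPairs G (tupleColouring G K) ⊆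
      (farVertices G K ×ˢ univ ∪ univ ×ˢ farVertices G K) ∪
        (univ : Finset (Fin (s + 1))).biUnion fun i =>
          (commonNbrs G (K ∘ i.succAbove)).biUnion fun x =>
            {y ∈ commonNbrs G (K ∘ i.succAbove) | G.Adj x y}.image fun y => (x, y) := by
    rintro ⟨x, y⟩ h
    simp only [badPairs, mem_filter, mem_univ, true_and] at h
    by_cases hx : x ∈ farVertices G K
    · simp [hx]
    by_cases hy : y ∈ farVertices G K
    · simp [hy]
    rw [mem_farVertices] at hx hy
    push Not at hx hy
    have h2 := h.2
    simp only [tupleColouring, dif_pos hx, dif_pos hy] at h2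
    refine mem_union_right _ (mem_biUnion.2 ⟨hx.choose, mem_univ _, mem_biUnion.2
      ⟨x, hx.choose_spec, mem_image.2 ⟨y, mem_filter.2 ⟨?_, h.1⟩, rfl⟩⟩⟩)
    rw [h2]
    exact hy.choose_spec
  have h1 := (card_le_card hsub).trans ((card_union_le _ _).trans
    (add_le_add (card_union_le _ _) (card_biUnion_le.trans
      (sum_le_sum fun i _ => card_biUnion_le.trans (sum_le_sum fun x _ => card_image_le)))))
  rw [card_product, card_product, card_univ] at h1
  have h2 : (#(badPairs G (tupleColouring G K)) : ℝ) ≤ (#(farVertices G K) * Fintype.card V +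
      Fintype.card V * #(farVertices G K)) +
      ∑ i : Fin (s + 1), ∑ x ∈ commonNbrs G (K ∘ i.succAbove),
        (#{y ∈ commonNbrs G (K ∘ i.succAbove) | G.Adj x y} : ℝ) := by
    exact_mod_cast h1
  linarith

theorem sum_edges_commonNbrs (s : ℕ) :
    ∑ k ∈ orderedCliques G s, ∑ x ∈ commonNbrs G k,
      (#{y ∈ commonNbrs G k | G.Adj x y} : ℝ) = #(orderedCliques G (s + 2)) := by
  rw [card_orderedCliques_succ G (s + 1),
    ← sum_orderedCliques_succ G 0 fun k x => (#{y ∈ commonNbrs G k | G.Adj x y} : ℝ)]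
  refine sum_congr rfl fun K _ => ?_
  congr 2
  ext y
  simp only [mem_filter, mem_commonNbrs, Function.comp_apply, Fin.zero_succAbove]
  rw [Fin.forall_fin_succ, and_comm]

theorem sum_card_badPairs_le (s : ℕ) :
    ∑ K ∈ orderedCliques G (s + 1), (#(badPairs G (tupleColouring G K)) : ℝ) ≤
      2 * Fintype.card V * ∑ K ∈ orderedCliques G (s + 1), (#(farVertices G K) : ℝ) +
        (s + 1) * (Fintype.card V * #(orderedCliques G (s + 2))) := by
  refine (sum_le_sum fun K _ => card_badPairs_tupleColouring_le G K).trans ?_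
  rw [sum_add_distrib, ← mul_sum, sum_comm]
  gcongr
  have h : ∀ i : Fin (s + 1), ∑ K ∈ orderedCliques G (s + 1),
      ∑ x ∈ commonNbrs G (K ∘ i.succAbove),
        (#{y ∈ commonNbrs G (K ∘ i.succAbove) | G.Adj x y} : ℝ) ≤
      Fintype.card V * #(orderedCliques G (s + 2)) := by
    intro i
    rw [sum_orderedCliques_succ G i fun k _ => ∑ x ∈ commonNbrs G k,
        (#{y ∈ commonNbrs G k | G.Adj x y} : ℝ), ← sum_edges_commonNbrs, mul_sum]
    refine sum_le_sum fun k _ => ?_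
    rw [sum_const, nsmul_eq_mul]
    have h0 : (0 : ℝ) ≤ ∑ x ∈ commonNbrs G k, (#{y ∈ commonNbrs G k | G.Adj x y} : ℝ) :=
      sum_nonneg fun _ _ => Nat.cast_nonneg _
    refine mul_le_mul_of_nonneg_right ?_ h0
    exact_mod_cast card_le_univ _
  refine (sum_le_sum fun i _ => h i).trans ?_
  rw [sum_const, card_univ, Fintype.card_fin, nsmul_eq_mul]
  push_cast
  exact le_rfl

/-- **Stability**: a graph with almost as many edges as the Turán graph and few ordered
`(r + 1)`-cliques is close to being `r`-partite. -/
theorem exists_colouring_card_badPairs_le (r : ℕ) (hr : 2 ≤ r) {η : ℝ} (hη : 0 < η) :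
    ∃ δ > 0, ∀ {V : Type} [Fintype V] [Nonempty V] (G : SimpleGraph V),
      (1 - 1 / (r : ℝ) - δ) * (Fintype.card V : ℝ) ^ 2 ≤ #{p : V × V | G.Adj p.1 p.2} →
      (#(orderedCliques G (r + 1)) : ℝ) ≤ δ * (Fintype.card V : ℝ) ^ (r + 1) →
      ∃ p : V → Fin r, (#(badPairs G p) : ℝ) ≤ η * (Fintype.card V : ℝ) ^ 2 := by
  have hr0 : (2 : ℝ) ≤ r := by exact_mod_cast hr
  set L : ℝ := 2 * (r : ℝ) ^ 2 + 3 * r * (2 * r) ^ r with hL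
  have hLpos : 0 < L := by positivity
  refine ⟨min (1 / (2 * (r : ℝ) ^ 2)) (η / L), by positivity, ?_⟩
  intro V _ _ G hG hN
  set δ : ℝ := min (1 / (2 * (r : ℝ) ^ 2)) (η / L)
  have hδ0 : 0 ≤ δ := by positivity
  have hδr : δ ≤ 1 / (2 * (r : ℝ) ^ 2) := min_le_left _ _
  have hδL : L * δ ≤ η := by
    have : δ ≤ η / L := min_le_right _ _
    rw [le_div_iff₀ hLpos] at this
    linarith
  have hn : (0 : ℝ) < Fintype.card V := by exact_mod_cast Fintype.card_pos
  obtain ⟨s, rfl⟩ : ∃ s, r = s + 1 := ⟨r - 1, by omega⟩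
  obtain ⟨h1, h2⟩ := orderedCliques_ratio G hr hδr hG s (by omega) le_rfl
  have h3 := card_orderedCliques_lower G hr hδr hG (s + 1) le_rfl
  have h4 := moon_moser_farVertices G s
  have h5 := sum_card_badPairs_le G s
  set n : ℝ := (Fintype.card V : ℝ)
  set A : ℝ := (#(orderedCliques G s) : ℝ)
  set B : ℝ := (#(orderedCliques G (s + 1)) : ℝ) with hB
  set C : ℝ := (#(orderedCliques G (s + 1 + 1)) : ℝ)
  set Z : ℝ := ∑ K ∈ orderedCliques G (s + 1), (#(farVertices G K) : ℝ)
  set R : ℝ := ((s + 1 : ℕ) : ℝ) with hR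
  have hRs : R = s + 1 := by rw [hR]; push_cast; rfl
  have hBpos : 0 < B := lt_of_lt_of_le (by positivity) h3
  have hC : C ≤ δ * (2 * R) ^ (s + 1) * (n * B) := by
    calc C ≤ δ * n ^ (s + 1 + 1) := hN
      _ = δ * (2 * R) ^ (s + 1) * (n * (n / (2 * R)) ^ (s + 1)) := by
          rw [div_pow, pow_succ n (s + 1)]
          field_simp
      _ ≤ _ := by gcongr
  have hZ : Z ≤ R ^ 2 * δ * (n * B) + R * C := by
    have h6 : A * ((s + 1) * ((1 - s * (1 / R + δ)) * n * B) + Z) ≤ A * (n * B + s * C) := by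
      have : (s + 1) * (((1 - s * (1 / R + δ)) * (n * A)) * B) ≤ (s + 1) * (B * B) := by
        gcongr
      nlinarith
    have h7 := le_of_mul_le_mul_left h6 h1
    have h8 : (s + 1 : ℝ) * (1 - s * (1 / R + δ)) = 1 - s * (s + 1) * δ := by
      have : R * (1 / R) = 1 := by
        rw [mul_one_div, div_self (by positivity)]
      rw [← hRs]
      have hs : (s : ℝ) = R - 1 := by linarith
      rw [hs]
      linear_combination (1 - R) * this
    have h9 : (s + 1) * ((1 - s * (1 / R + δ)) * n * B) = (1 - s * (s + 1) * δ) * (n * B) := by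
      rw [← h8]; ring
    have hC0 : 0 ≤ C := Nat.cast_nonneg _
    have hs0 : (0 : ℝ) ≤ s := Nat.cast_nonneg _
    have h10 : (s : ℝ) * (s + 1) * δ * (n * B) ≤ R ^ 2 * δ * (n * B) := by
      gcongr
      rw [hRs]
      nlinarith
    have h11 : s * C ≤ R * C := by
      gcongr
      linarith
    linarith
  have h6 : ∑ K ∈ orderedCliques G (s + 1), (#(badPairs G (tupleColouring G K)) : ℝ) ≤
      #(orderedCliques G (s + 1)) • (η * n ^ 2) := by
    rw [nsmul_eq_mul]
    calc _ ≤ 2 * n * Z + R * (n * C) := by rw [hRs]; exact h5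
      _ ≤ 2 * n * (R ^ 2 * δ * (n * B) + R * C) + R * (n * C) := by gcongr
      _ = 2 * R ^ 2 * δ * (n ^ 2 * B) + 3 * R * n * C := by ring
      _ ≤ 2 * R ^ 2 * δ * (n ^ 2 * B) + 3 * R * n * (δ * (2 * R) ^ (s + 1) * (n * B)) := by
          gcongr
      _ = L * δ * (n ^ 2 * B) := by rw [hL]; ring
      _ ≤ η * (n ^ 2 * B) := by gcongr
      _ = B * (η * n ^ 2) := by ring
  obtain ⟨K, _, hK⟩ := exists_le_of_sum_le
    (card_pos.1 (by rw [hB] at hBpos; exact_mod_cast hBpos))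
    (h6.trans_eq (sum_const _).symm)
  exact ⟨_, hK⟩

end Stability

section Embeddings

variable {α V : Type} [Fintype α] [Fintype V]

/-- The edge-preserving injections from `F` to `H`. -/
noncomputable def embeddings (F : SimpleGraph α) (H : SimpleGraph V) : Finset (α → V) :=
  {φ | Function.Injective φ ∧ ∀ ⦃u v⦄, F.Adj u v → H.Adj (φ u) (φ v)}

/-- The complete multipartite graph with colouring `t`, plus the edge `uv`. -/
def multipartitePlus {r : ℕ} (t : V → Fin r) (u v : V) : SimpleGraph V :=
  (⊤ : SimpleGraph (Fin r)).comap t ⊔ fromEdgeSet {s(u, v)}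

theorem mem_embeddings {F : SimpleGraph α} {H : SimpleGraph V} {φ : α → V} :
    φ ∈ embeddings F H ↔ Function.Injective φ ∧ ∀ ⦃u v⦄, F.Adj u v → H.Adj (φ u) (φ v) := by
  simp [embeddings]

omit [Fintype V] in
theorem multipartitePlus_adj {r : ℕ} {t : V → Fin r} {u v x y : V} :
    (multipartitePlus t u v).Adj x y ↔ t x ≠ t y ∨ s(x, y) = s(u, v) ∧ x ≠ y := by
  simp [multipartitePlus]

theorem natCard_embedding_subtype (Q : (α → V) → Prop) :
    Nat.card {f : α ↪ V // Q f} = #{φ : α → V | Function.Injective φ ∧ Q φ} := by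
  rw [← Fintype.card_subtype, ← Nat.card_eq_fintype_card]
  exact Nat.card_congr
    { toFun := fun f => ⟨f.1, f.1.injective, f.2⟩
      invFun := fun φ => ⟨⟨φ.1, φ.2.1⟩, φ.2.2⟩
      left_inv := fun f => rfl
      right_inv := fun φ => rfl }

theorem card_diagonal_le : #{e : V × V | e.1 = e.2} ≤ Fintype.card V := by
  rw [← card_univ]
  refine card_le_card_of_injOn Prod.fst (fun _ _ => mem_coe.2 (mem_univ _)) ?_
  rintro ⟨x, y⟩ h ⟨x', y'⟩ h' hx
  simp only [coe_filter, mem_univ, true_and, Set.mem_ofPred_eq] at h h' hx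
  rw [← h, ← h', hx]

theorem pow_le_card_forall_mem (X : Finset α) (S : α → Finset V) {g : ℝ} (hg : 0 ≤ g)
    (h1 : ∀ w ∈ X, 1 ≤ #(S w)) (h : ∀ w ∉ X, g ≤ #(S w)) :
    g ^ (Fintype.card α - #X) ≤ #{φ : α → V | ∀ w, φ w ∈ S w} := by
  have : ({φ : α → V | ∀ w, φ w ∈ S w} : Finset (α → V)) = Fintype.piFinset S := by
    ext φ; simp
  rw [this, Fintype.card_piFinset, Nat.cast_prod, ← card_compl, ← prod_mul_prod_compl X]
  calc g ^ #Xᶜ = ∏ _w ∈ Xᶜ, g := by rw [prod_const]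
    _ ≤ ∏ w ∈ Xᶜ, (#(S w) : ℝ) := prod_le_prod (fun _ _ => hg) fun w hw => h w (by simpa using hw)
    _ ≤ (∏ w ∈ X, (#(S w) : ℝ)) * ∏ w ∈ Xᶜ, (#(S w) : ℝ) := by
      refine le_mul_of_one_le_left (prod_nonneg fun _ _ => Nat.cast_nonneg _) ?_
      have : (∏ _w ∈ X, (1 : ℝ)) ≤ ∏ w ∈ X, (#(S w) : ℝ) :=
        prod_le_prod (fun _ _ => zero_le_one) fun w hw => by exact_mod_cast h1 w hw
      simpa using this

variable {F : SimpleGraph α} {r : ℕ}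

/-- Every embedding into a complete `r`-partite graph plus one edge uses that edge. -/
theorem exists_adj_of_mem_embeddings_multipartitePlus (hF : ¬ F.Colorable r) {t : V → Fin r}
    {u v : V} {φ : α → V} (hφ : φ ∈ embeddings F (multipartitePlus t u v)) :
    ∃ w z, F.Adj w z ∧ φ w = u ∧ φ z = v := by
  by_contra! hcon
  refine hF ⟨Coloring.mk (fun w => t (φ w)) fun {w z} hwz => ?_⟩
  rcases multipartitePlus_adj.1 ((mem_embeddings.1 hφ).2 hwz) with h | ⟨h, -⟩
  · exact h
  · rw [Sym2.eq_iff] at h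
    rcases h with ⟨h1, h2⟩ | ⟨h1, h2⟩
    · exact absurd h2 (hcon w z hwz h1)
    · exact absurd h1 (hcon z w hwz.symm h2)

variable [Nonempty V]

theorem card_embeddings_multipartitePlus_le (hF : ¬ F.Colorable r) (t : V → Fin r) (u v : V) :
    (#(embeddings F (multipartitePlus t u v)) : ℝ) ≤ (Fintype.card α : ℝ) ^ 2 *
      (1 / (Fintype.card V : ℝ) ^ 2 * (Fintype.card V : ℝ) ^ Fintype.card α) := by
  refine le_trans ?_ (card_exists_pair_le
    (fun w z (φ : α → V) => w ≠ z ∧ φ w = u ∧ φ z = v) fun w z => ?_)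
  · norm_cast
    refine card_le_card fun φ hφ => mem_filter.2 ⟨mem_univ _, ?_⟩
    obtain ⟨w, z, hwz, h⟩ := exists_adj_of_mem_embeddings_multipartitePlus hF hφ
    exact ⟨w, z, hwz.ne, h⟩
  · by_cases hwz : w = z
    · simp only [hwz, ne_eq, not_true_eq_false, false_and, filter_false, card_empty, Nat.cast_zero]
      positivity
    · simpa [hwz] using card_two_values_le (V := V) hwz u v

/-- `χ` is an `r`-colouring of `F` whose only monochromatic edge is `ab`. -/
structure IsAlmostColouring (F : SimpleGraph α) (χ : α → Fin r) (a b : α) : Prop where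
  adj : F.Adj a b
  eq : χ a = χ b
  ne : ∀ ⦃w z⦄, F.Adj w z → s(w, z) ≠ s(a, b) → χ w ≠ χ z

omit [Fintype α] in
theorem IsAlmostColouring.swap {χ : α → Fin r} {a b : α} (h : IsAlmostColouring F χ a b)
    (j : Fin r) : IsAlmostColouring F (fun w => Equiv.swap (χ a) j (χ w)) a b where
  adj := h.adj
  eq := by rw [h.eq]
  ne w z hwz hne := by simpa using h.ne hwz hne

theorem card_embeddings_multipartitePlus_ge {χ : α → Fin r} {a b : α}
    (hχ : IsAlmostColouring F χ a b) {t : V → Fin r} {g : ℝ} (hg : 0 ≤ g)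
    (ht : ∀ j, g ≤ #{v | t v = j}) {u v : V} (huv : u ≠ v) (htuv : t u = t v) :
    g ^ (Fintype.card α - 2) - (Fintype.card α : ℝ) ^ 2 *
      ((1 / (Fintype.card V : ℝ) ^ 3 + Fintype.card V / (Fintype.card V : ℝ) ^ 4) *
        (Fintype.card V : ℝ) ^ Fintype.card α) ≤
      #(embeddings F (multipartitePlus t u v)) := by
  have hab := hχ.adj.ne
  set χ' : α → Fin r := fun w => Equiv.swap (χ a) (t u) (χ w) with hχ'
  have hc : IsAlmostColouring F χ' a b := hχ.swap _
  have hca : χ' a = t u := by simp [hχ']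
  have hcb : χ' b = t u := by rw [← hc.eq, hca]
  set S : α → Finset V := fun w =>
    if w = a then {u} else if w = b then {v} else ({x | t x = χ' w} : Finset V) with hS
  have h1 : g ^ (Fintype.card α - 2) ≤ #{φ : α → V | ∀ w, φ w ∈ S w} := by
    have := pow_le_card_forall_mem {a, b} S hg ?_ ?_
    · rwa [card_pair hab] at this
    · intro w hw
      rcases mem_insert.1 hw with rfl | hw
      · simp [hS]
      · rw [mem_singleton.1 hw]; simp [hS, hab.symm]
    · intro w hw
      rw [mem_insert, mem_singleton, not_or] at hw
      simpa [hS, hw.1, hw.2] using ht (χ' w)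
  have hR := card_two_values_exists_rel_le hab u v (fun x y : V => x = y) (fun _ _ h => h.symm)
    (d := 1) (m := Fintype.card V) (by simp [filter_eq]) (by simp [filter_eq])
    (by exact_mod_cast card_diagonal_le)
  obtain ⟨B, hB, hBcard⟩ : ∃ B : Finset (α → V), (∀ φ, φ ∈ B ↔ φ a = u ∧ φ b = v ∧
      ∃ w z, w ≠ z ∧ s(w, z) ≠ s(a, b) ∧ φ w = φ z) ∧ (#B : ℝ) ≤ _ := ⟨_, by simp, hR⟩
  have hsub : ({φ : α → V | ∀ w, φ w ∈ S w} : Finset (α → V)) ⊆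
      embeddings F (multipartitePlus t u v) ∪ B := by
    intro φ hφ
    have hφ := (mem_filter.1 hφ).2
    have hφa : φ a = u := by simpa [hS] using hφ a
    have hφb : φ b = v := by simpa [hS, hab.symm] using hφ b
    have hcol : ∀ w, t (φ w) = χ' w := by
      intro w
      by_cases hwa : w = a
      · rw [hwa, hφa, hca]
      by_cases hwb : w = b
      · rw [hwb, hφb, hcb, htuv]
      simpa [hS, hwa, hwb] using hφ w
    rw [mem_union, or_iff_not_imp_right]
    intro hno
    simp only [hB, hφa, hφb, true_and, not_exists, not_and] at hno
    have hinj : Function.Injective φ := by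
      intro w z hwz
      by_contra hne
      by_cases hs : s(w, z) = s(a, b)
      · rcases Sym2.eq_iff.1 hs with ⟨rfl, rfl⟩ | ⟨rfl, rfl⟩
        · exact huv (hφa.symm.trans (hwz.trans hφb))
        · exact huv (hφa.symm.trans (hwz.symm.trans hφb))
      · exact hno w z hne hs hwz
    refine mem_embeddings.2 ⟨hinj, fun w z hwz => multipartitePlus_adj.2 ?_⟩
    by_cases hs : s(w, z) = s(a, b)
    · right
      refine ⟨?_, fun h => hwz.ne (hinj h)⟩
      rcases Sym2.eq_iff.1 hs with ⟨rfl, rfl⟩ | ⟨rfl, rfl⟩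
      · rw [hφa, hφb]
      · rw [hφa, hφb, Sym2.eq_swap]
    · left
      rw [hcol, hcol]
      exact hc.ne hwz hs
  have h2 : (#{φ : α → V | ∀ w, φ w ∈ S w} : ℝ) ≤ #(embeddings F (multipartitePlus t u v)) + #B := by
    norm_cast
    exact (card_le_card hsub).trans (card_union_le _ _)
  linarith

/-- A vertex with many neighbours in each part of an almost complete multipartite graph lies in
many embeddings. -/
theorem card_embeddings_through_ge {χ : α → Fin r} {a b : α}
    (hχ : IsAlmostColouring F χ a b) {H : SimpleGraph V} {p : V → Fin r} {x : V} {g m : ℝ}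
    (hg : 0 ≤ g) (hx : ∀ j, g ≤ #{y | H.Adj x y ∧ p y = j})
    (hm : (#{e : V × V | p e.1 ≠ p e.2 ∧ ¬ H.Adj e.1 e.2} : ℝ) ≤ m) :
    g ^ (Fintype.card α - 1) - (Fintype.card α : ℝ) ^ 2 *
      ((Fintype.card V + m) / (Fintype.card V : ℝ) ^ 3 *
        (Fintype.card V : ℝ) ^ Fintype.card α) ≤
      #{φ ∈ embeddings F H | ∃ w, φ w = x} := by
  set S : α → Finset V := fun w =>
    if w = a then {x} else ({y | H.Adj x y ∧ p y = χ w} : Finset V) with hS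
  have h1 : g ^ (Fintype.card α - 1) ≤ #{φ : α → V | ∀ w, φ w ∈ S w} := by
    have := pow_le_card_forall_mem {a} S hg ?_ ?_
    · rwa [card_singleton] at this
    · intro w hw
      simp [hS, mem_singleton.1 hw]
    · intro w hw
      rw [mem_singleton] at hw
      simpa [hS, hw] using hx (χ w)
  obtain ⟨R, hR⟩ : ∃ R : V → V → Prop, ∀ y z, R y z ↔ y = z ∨ p y ≠ p z ∧ ¬ H.Adj y z :=
    ⟨_, fun _ _ => Iff.rfl⟩
  have hRm : (#{e : V × V | R e.1 e.2} : ℝ) ≤ Fintype.card V + m := by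
    have h1 : #{e : V × V | R e.1 e.2} ≤ #{e : V × V | e.1 = e.2} +
        #{e : V × V | p e.1 ≠ p e.2 ∧ ¬ H.Adj e.1 e.2} := by
      refine le_trans (card_le_card fun e he => ?_) (card_union_le _ _)
      simpa [hR] using he
    have h2 : (#{e : V × V | R e.1 e.2} : ℝ) ≤ Fintype.card V +
        #{e : V × V | p e.1 ≠ p e.2 ∧ ¬ H.Adj e.1 e.2} := by
      exact_mod_cast h1.trans (Nat.add_le_add_right card_diagonal_le _)
    linarith
  obtain ⟨B, hB, hBcard⟩ : ∃ B : Finset (α → V), (∀ φ, φ ∈ B ↔ φ a = x ∧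
      ∃ w z, w ≠ a ∧ z ≠ a ∧ w ≠ z ∧ R (φ w) (φ z)) ∧ (#B : ℝ) ≤
      (Fintype.card α : ℝ) ^ 2 * ((Fintype.card V + m) / (Fintype.card V : ℝ) ^ 3 *
        (Fintype.card V : ℝ) ^ Fintype.card α) := by
    refine ⟨_, by simp, (card_value_exists_rel_le a x R).trans ?_⟩
    gcongr
  have hsub : ({φ : α → V | ∀ w, φ w ∈ S w} : Finset (α → V)) ⊆
      {φ ∈ embeddings F H | ∃ w, φ w = x} ∪ B := by
    intro φ hφ
    have hφ := (mem_filter.1 hφ).2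
    have hφa : φ a = x := by simpa [hS] using hφ a
    have hcol : ∀ w, w ≠ a → H.Adj x (φ w) ∧ p (φ w) = χ w := by
      intro w hwa
      simpa [hS, hwa] using hφ w
    rw [mem_union, or_iff_not_imp_right]
    intro hno
    simp only [hB, hφa, true_and, not_exists, not_and] at hno
    have hinj : Function.Injective φ := by
      intro w z hwz
      by_contra hne
      by_cases hwa : w = a
      · have := (hcol z (fun h => hne (hwa.trans h.symm))).1
        rw [← hwz, hwa, hφa] at this
        exact this.ne rfl
      by_cases hza : z = a
      · have := (hcol w hwa).1
        rw [hwz, hza, hφa] at this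
        exact this.ne rfl
      exact hno w z hwa hza hne ((hR _ _).2 (Or.inl hwz))
    refine mem_filter.2 ⟨mem_embeddings.2 ⟨hinj, fun w z hwz => ?_⟩, a, hφa⟩
    by_cases hwa : w = a
    · rw [hwa, hφa]
      exact (hcol z fun h => hwz.ne (hwa.trans h.symm)).1
    by_cases hza : z = a
    · rw [hza, hφa]
      exact (hcol w hwa).1.symm
    by_contra hnot
    refine hno w z hwa hza hwz.ne ((hR _ _).2 (Or.inr ⟨?_, hnot⟩))
    rw [(hcol w hwa).2, (hcol z hza).2]
    refine hχ.ne hwz fun hs => ?_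
    rcases Sym2.eq_iff.1 hs with ⟨h, -⟩ | ⟨-, h⟩
    · exact hwa h
    · exact hza h
  have h2 : (#{φ : α → V | ∀ w, φ w ∈ S w} : ℝ) ≤ #{φ ∈ embeddings F H | ∃ w, φ w = x} + #B := by
    norm_cast
    exact (card_le_card hsub).trans (card_union_le _ _)
  linarith

end Embeddings

section Permuting

variable {V : Type} [Fintype V] {r : ℕ}

/-- Two colourings with similar class sizes agree, up to a permutation of the vertices, outside a
small set; two given vertices of equal colour can be matched. -/
theorem exists_perm_agreeing {t p : V → Fin r} {D : ℕ}
    (hD : ∀ j, #{v | t v = j} ≤ #{v | p v = j} + D) {u v x y : V} (huv : u ≠ v) (hxy : x ≠ y)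
    (hu : t u = p x) (hv : t v = p y) :
    ∃ σ : Equiv.Perm V, σ u = x ∧ σ v = y ∧ #{w | p (σ w) ≠ t w} ≤ r * D := by
  have hne : ({σ : Equiv.Perm V | σ u = x ∧ σ v = y} : Finset _).Nonempty := by
    refine ⟨(Equiv.swap u x).trans (Equiv.swap (Equiv.swap u x v) y), ?_⟩
    have h1 : x ≠ Equiv.swap u x v := by
      intro h
      have := (Equiv.swap u x).injective ((Equiv.swap_apply_left u x).trans h)
      exact huv this
    simp [Equiv.swap_apply_of_ne_of_ne h1 hxy]
  obtain ⟨σ, hσ, hmax⟩ := exists_max_image _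
    (fun σ : Equiv.Perm V => #{w | p (σ w) = t w}) hne
  simp only [mem_filter, mem_univ, true_and, and_imp] at hσ hmax
  refine ⟨σ, hσ.1, hσ.2, ?_⟩
  have hclass : ∀ j, #{w | t w = j ∧ p (σ w) ≠ j} ≤ D := by
    intro j
    by_contra! hlt
    have h1 : #{w | t w = j} = #{w | t w = j ∧ p (σ w) = j} + #{w | t w = j ∧ p (σ w) ≠ j} := by
      rw [← filter_filter, ← filter_filter, card_filter_add_card_filter_not]
    have h2 : #{w | p w = j} = #{w | p (σ w) = j} := by
      refine (card_bij (fun w _ => σ w) ?_ ?_ ?_).symm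
      · simp
      · intro a _ b _ h; exact σ.injective h
      · intro b hb
        exact ⟨σ.symm b, by simpa using hb, by simp⟩
    have h3 : #{w | p (σ w) = j} = #{w | t w = j ∧ p (σ w) = j} +
        #{w | p (σ w) = j ∧ t w ≠ j} := by
      rw [← card_filter_add_card_filter_not (s := {w | p (σ w) = j}) (fun w => t w = j),
        filter_filter, filter_filter]
      simp only [and_comm]
    have h4 := hD j
    obtain ⟨a, ha⟩ := card_pos.1 (by omega : 0 < #{w | t w = j ∧ p (σ w) ≠ j})
    obtain ⟨b, hb⟩ := card_pos.1 (by omega : 0 < #{w | p (σ w) = j ∧ t w ≠ j})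
    simp only [mem_filter, mem_univ, true_and] at ha hb
    have hua : ∀ z, p (σ z) = t z → z ≠ a ∧ z ≠ b := by
      rintro z hz
      refine ⟨?_, ?_⟩ <;> rintro rfl
      · exact ha.2 (hz.trans ha.1)
      · exact hb.2 (hz.symm.trans hb.1)
    have hu' := hua u (by rw [hσ.1, hu])
    have hv' := hua v (by rw [hσ.2, hv])
    have := hmax ((Equiv.swap a b).trans σ)
      (by simp [Equiv.swap_apply_of_ne_of_ne hu'.1 hu'.2, hσ.1])
      (by simp [Equiv.swap_apply_of_ne_of_ne hv'.1 hv'.2, hσ.2])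
    refine absurd this (not_le.2 (card_lt_card ?_))
    rw [Finset.ssubset_iff_of_subset]
    · refine ⟨a, ?_, ?_⟩
      · refine mem_filter.2 ⟨mem_univ _, ?_⟩
        simp [hb.1, ha.1]
      · simp only [mem_filter, mem_univ, true_and]
        exact fun h => ha.2 (h.trans ha.1)
    · intro z hz
      simp only [mem_filter, mem_univ, true_and] at hz ⊢
      have := hua z hz
      simpa [Equiv.swap_apply_of_ne_of_ne this.1 this.2] using hz
  calc #{w | p (σ w) ≠ t w} = ∑ j : Fin r, #{w ∈ ({w | p (σ w) ≠ t w} : Finset V) | t w = j} :=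
        card_eq_sum_card_fiberwise fun _ _ => mem_coe.2 (mem_univ _)
    _ ≤ ∑ _j : Fin r, D := by
        refine sum_le_sum fun j _ => (card_le_card fun w hw => ?_).trans (hclass j)
        simp only [mem_filter, mem_univ, true_and] at hw ⊢
        exact ⟨hw.2, hw.2 ▸ hw.1⟩
    _ = r * D := by simp

/-- An edge inside a class of an almost complete multipartite graph, whose ends miss few
neighbours in other classes, lies in almost as many embeddings as in the complete case. -/
theorem card_embeddings_edge_ge [Nonempty V] {α : Type} [Fintype α] {F : SimpleGraph α}
    (hF : ¬ F.Colorable r) {H : SimpleGraph V} {t p : V → Fin r} {D : ℕ}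
    (hD : ∀ j, #{v | t v = j} ≤ #{v | p v = j} + D) {u v x y : V} (huv : u ≠ v)
    (hu : t u = p x) (hv : t v = p y) (hxy : H.Adj x y) (hp : p x = p y) {d m : ℝ}
    (hx : (#{w | p x ≠ p w ∧ ¬ H.Adj x w} : ℝ) ≤ d)
    (hy : (#{w | p y ≠ p w ∧ ¬ H.Adj y w} : ℝ) ≤ d)
    (hm : (#{e : V × V | p e.1 ≠ p e.2 ∧ ¬ H.Adj e.1 e.2} : ℝ) ≤ m) :
    (#(embeddings F (multipartitePlus t u v)) : ℝ) ≤
      #{φ ∈ embeddings F H | ∃ w z, F.Adj w z ∧ s(φ w, φ z) = s(x, y)} +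
      (Fintype.card α : ℝ) ^ 2 * ((Fintype.card α : ℝ) ^ 2 *
        (((d + r * D) / (Fintype.card V : ℝ) ^ 3 +
          (m + 2 * (Fintype.card V * (r * D))) / (Fintype.card V : ℝ) ^ 4) *
        (Fintype.card V : ℝ) ^ Fintype.card α)) := by
  obtain ⟨σ, hσu, hσv, hσ⟩ := exists_perm_agreeing hD huv hxy.ne hu hv
  have hσ' : (#{w | p (σ w) ≠ t w} : ℝ) ≤ r * D := by exact_mod_cast hσ
  obtain ⟨R, hR⟩ : ∃ R : V → V → Prop, ∀ a b, R a b ↔ t a ≠ t b ∧ ¬ H.Adj (σ a) (σ b) :=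
    ⟨_, fun _ _ => Iff.rfl⟩
  have hRs : ∀ a b, R a b → R b a := fun a b h => by
    rw [hR] at h ⊢
    exact ⟨h.1.symm, fun h' => h.2 h'.symm⟩
  have hdeg : ∀ a b, σ a = b → t a = p b → (#{w | p b ≠ p w ∧ ¬ H.Adj b w} : ℝ) ≤ d →
      (#{w | R a w} : ℝ) ≤ d + r * D := by
    intro a b hab htab hb
    have h1 : #{w | R a w} ≤ #{w | p b ≠ p w ∧ ¬ H.Adj b w} + #{w | p (σ w) ≠ t w} := by
      have h2 : #(({w | p b ≠ p w ∧ ¬ H.Adj b w} : Finset V).image σ.symm) =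
          #{w | p b ≠ p w ∧ ¬ H.Adj b w} := card_image_of_injective _ σ.symm.injective
      rw [← h2]
      refine (card_le_card fun w hw => ?_).trans (card_union_le _ _)
      simp only [mem_filter, mem_univ, true_and, hR, hab, htab] at hw
      rw [mem_union, or_iff_not_imp_right]
      intro hw'
      simp only [mem_filter, mem_univ, true_and, ne_eq, not_not] at hw'
      refine mem_image.2 ⟨σ w, ?_, by simp⟩
      simpa [hw'] using hw
    have h3 : (#{w | R a w} : ℝ) ≤ #{w | p b ≠ p w ∧ ¬ H.Adj b w} + #{w | p (σ w) ≠ t w} := by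
      exact_mod_cast h1
    linarith
  have htot : (#{e : V × V | R e.1 e.2} : ℝ) ≤ m + 2 * (Fintype.card V * (r * D)) := by
    have h1 : #{e : V × V | R e.1 e.2} ≤ #{e : V × V | p e.1 ≠ p e.2 ∧ ¬ H.Adj e.1 e.2} +
        (#(({w | p (σ w) ≠ t w} : Finset V) ×ˢ (univ : Finset V)) +
          #((univ : Finset V) ×ˢ ({w | p (σ w) ≠ t w} : Finset V))) := by
      have h2 : #(({e : V × V | p e.1 ≠ p e.2 ∧ ¬ H.Adj e.1 e.2} : Finset (V × V)).image
          (Prod.map σ.symm σ.symm)) = #{e : V × V | p e.1 ≠ p e.2 ∧ ¬ H.Adj e.1 e.2} :=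
        card_image_of_injective _ (σ.symm.injective.prodMap σ.symm.injective)
      rw [← h2]
      refine (card_le_card fun e he => ?_).trans ((card_union_le _ _).trans
        (Nat.add_le_add_left (card_union_le _ _) _))
      simp only [mem_filter, mem_univ, true_and, hR] at he
      simp only [mem_union, mem_product, mem_filter, mem_univ, true_and, and_true, ne_eq]
      by_cases h3 : p (σ e.1) = t e.1
      · by_cases h4 : p (σ e.2) = t e.2
        · left
          refine mem_image.2 ⟨(σ e.1, σ e.2), ?_, by simp⟩
          simpa [h3, h4] using he
        · exact Or.inr (Or.inr h4)
      · exact Or.inr (Or.inl h3)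
    rw [card_product, card_product, card_univ] at h1
    have h3 : (#{e : V × V | R e.1 e.2} : ℝ) ≤ #{e : V × V | p e.1 ≠ p e.2 ∧ ¬ H.Adj e.1 e.2} +
        (#{w | p (σ w) ≠ t w} * Fintype.card V + Fintype.card V * #{w | p (σ w) ≠ t w}) := by
      exact_mod_cast h1
    have h4 : (Fintype.card V : ℝ) * #{w | p (σ w) ≠ t w} ≤ Fintype.card V * (r * D) := by gcongr
    linarith
  have hud := hdeg u x hσu hu hx
  have hvd := hdeg v y hσv hv hy
  have htuv : t u = t v := by rw [hu, hv, hp]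
  obtain ⟨B, hB, hBcard⟩ : ∃ B : Finset (α → V), (∀ φ, φ ∈ B ↔ ∃ a b, a ≠ b ∧ φ a = u ∧ φ b = v ∧
      ∃ w z, w ≠ z ∧ s(w, z) ≠ s(a, b) ∧ R (φ w) (φ z)) ∧ (#B : ℝ) ≤
      (Fintype.card α : ℝ) ^ 2 * ((Fintype.card α : ℝ) ^ 2 *
        (((d + r * D) / (Fintype.card V : ℝ) ^ 3 +
          (m + 2 * (Fintype.card V * (r * D))) / (Fintype.card V : ℝ) ^ 4) *
        (Fintype.card V : ℝ) ^ Fintype.card α)) := by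
    refine ⟨_, by simp, card_exists_pair_le (fun a b (φ : α → V) => a ≠ b ∧ φ a = u ∧ φ b = v ∧
      ∃ w z, w ≠ z ∧ s(w, z) ≠ s(a, b) ∧ R (φ w) (φ z)) fun a b => ?_⟩
    by_cases hab : a = b
    · simp only [hab, ne_eq, not_true_eq_false, false_and, filter_false, card_empty, Nat.cast_zero]
      have : 0 ≤ d + r * D := (Nat.cast_nonneg _).trans hud
      have : 0 ≤ m + 2 * (Fintype.card V * (r * D)) := (Nat.cast_nonneg _).trans htot
      positivity
    · simpa [hab] using card_two_values_exists_rel_le hab u v R hRs hud hvd htot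
  have hcard : #(embeddings F (multipartitePlus t u v)) ≤
      #{φ ∈ embeddings F H | ∃ w z, F.Adj w z ∧ s(φ w, φ z) = s(x, y)} + #B := by
    have h1 : #((embeddings F (multipartitePlus t u v) \ B).image (fun φ => σ ∘ φ)) =
        #(embeddings F (multipartitePlus t u v) \ B) :=
      card_image_of_injective _ σ.injective.comp_left
    have h2 : #(embeddings F (multipartitePlus t u v)) ≤
        #(embeddings F (multipartitePlus t u v) \ B) + #B := by
      have := le_card_sdiff B (embeddings F (multipartitePlus t u v))
      omega
    refine h2.trans (Nat.add_le_add_right ?_ _)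
    rw [← h1]
    refine card_le_card fun ψ hψ => ?_
    obtain ⟨φ, hφ, rfl⟩ := mem_image.1 hψ
    obtain ⟨hφ, hφB⟩ := mem_sdiff.1 hφ
    obtain ⟨a, b, hab, hφa, hφb⟩ := exists_adj_of_mem_embeddings_multipartitePlus hF hφ
    obtain ⟨hinj, hadj⟩ := mem_embeddings.1 hφ
    refine mem_filter.2 ⟨mem_embeddings.2 ⟨σ.injective.comp hinj, fun w z hwz => ?_⟩,
      a, b, hab, by simp [hφa, hφb, hσu, hσv]⟩
    rcases multipartitePlus_adj.1 (hadj hwz) with h | ⟨h, -⟩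
    · by_contra hnot
      refine hφB ((hB φ).2 ⟨a, b, hab.ne, hφa, hφb, w, z, hwz.ne, fun hs => h ?_,
        (hR _ _).2 ⟨h, hnot⟩⟩)
      rcases Sym2.eq_iff.1 hs with ⟨rfl, rfl⟩ | ⟨rfl, rfl⟩
      · rw [hφa, hφb, htuv]
      · rw [hφa, hφb, htuv]
    · rcases Sym2.eq_iff.1 h with ⟨h1, h2⟩ | ⟨h1, h2⟩
      · simpa [h1, h2, hσu, hσv] using hxy
      · simpa [h1, h2, hσu, hσv] using hxy.symm
  have hcard' : (#(embeddings F (multipartitePlus t u v)) : ℝ) ≤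
      #{φ ∈ embeddings F H | ∃ w z, F.Adj w z ∧ s(φ w, φ z) = s(x, y)} + #B := by
    exact_mod_cast hcard
  linarith

end Permuting

section Cuts

variable {V : Type} [Fintype V] {r : ℕ}

theorem card_sameColour (p : V → Fin r) :
    #{e : V × V | p e.1 = p e.2} = ∑ j, #{v | p v = j} ^ 2 := by
  rw [card_eq_sum_card_fiberwise (f := fun e : V × V => p e.1) (t := univ)
    fun _ _ => mem_coe.2 (mem_univ _)]
  refine sum_congr rfl fun j _ => ?_
  rw [sq, ← card_product]
  congr 1
  ext e
  simp only [mem_filter, mem_univ, true_and, mem_product]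
  grind

theorem card_sameColour_add (p : V → Fin r) :
    (#{e : V × V | p e.1 ≠ p e.2} : ℝ) + ∑ j, (#{v | p v = j} : ℝ) ^ 2 =
      (Fintype.card V : ℝ) ^ 2 := by
  have h := card_filter_add_card_filter_not (s := (univ : Finset (V × V))) fun e => p e.1 = p e.2
  rw [card_sameColour, card_univ, Fintype.card_prod, ← sq] at h
  rw [add_comm]
  exact_mod_cast h

theorem sum_card_colour (p : V → Fin r) : ∑ j, (#{v | p v = j} : ℝ) = Fintype.card V := by
  have := card_eq_sum_card_fiberwise (s := (univ : Finset V)) (f := p) (t := univ)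
    fun _ _ => mem_coe.2 (mem_univ _)
  rw [card_univ] at this
  exact_mod_cast this.symm

/-- The balanced colouring has the most bichromatic pairs. -/
theorem card_bichromatic_le {t : V → Fin r} {m : ℕ}
    (ht : ∀ j, #{v | t v = j} = m ∨ #{v | t v = j} = m + 1) (p : V → Fin r) :
    (#{e : V × V | p e.1 ≠ p e.2} : ℝ) ≤ #{e : V × V | t e.1 ≠ t e.2} := by
  have h1 := card_sameColour_add p
  have h2 := card_sameColour_add t
  have h3 : ∑ j, (#{v | t v = j} : ℝ) ^ 2 =
      ∑ j, ((2 * (m : ℝ) + 1) * (#{v | t v = j} : ℝ) - m * (m + 1)) := by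
    refine sum_congr rfl fun j _ => ?_
    rcases ht j with h | h <;> rw [h] <;> push_cast <;> ring
  have h4 : ∑ j, ((2 * (m : ℝ) + 1) * (#{v | p v = j} : ℝ) - m * (m + 1)) ≤
      ∑ j, (#{v | p v = j} : ℝ) ^ 2 := by
    refine sum_le_sum fun j _ => ?_
    rcases le_or_gt #{v | p v = j} m with h | h
    · have : (#{v | p v = j} : ℝ) ≤ m := by exact_mod_cast h
      nlinarith
    · have : (m : ℝ) + 1 ≤ #{v | p v = j} := by exact_mod_cast h
      nlinarith
  rw [sum_sub_distrib, ← mul_sum, sum_card_colour] at h3 h4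
  linarith

theorem balanced_card_mem {t : V → Fin r} (hr : 0 < r) {m : ℕ}
    (ht : ∀ j, #{v | t v = j} = m ∨ #{v | t v = j} = m + 1) (j : Fin r) :
    (Fintype.card V : ℝ) / r - 1 ≤ #{v | t v = j} ∧
      (#{v | t v = j} : ℝ) ≤ Fintype.card V / r + 1 := by
  have hr' : (0 : ℝ) < r := by exact_mod_cast hr
  have hsum := sum_card_colour t
  have hle : ∀ j, (m : ℝ) ≤ #{v | t v = j} ∧ (#{v | t v = j} : ℝ) ≤ m + 1 := fun j => by
    rcases ht j with h | h <;> rw [h] <;> push_cast <;> constructor <;> linarith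
  have h1 : (r : ℝ) * m ≤ Fintype.card V := by
    rw [← hsum]
    have : ∑ _j : Fin r, (m : ℝ) = r * m := by simp
    rw [← this]
    exact sum_le_sum fun j _ => (hle j).1
  have h2 : (Fintype.card V : ℝ) ≤ r * (m + 1) := by
    rw [← hsum]
    have : ∑ _j : Fin r, ((m : ℝ) + 1) = r * (m + 1) := by simp [mul_add]
    rw [← this]
    exact sum_le_sum fun j _ => (hle j).2
  have h3 : (m : ℝ) ≤ Fintype.card V / r := by
    rw [le_div_iff₀ hr']; linarith
  have h4 : (Fintype.card V : ℝ) / r ≤ m + 1 := by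
    rw [div_le_iff₀ hr']; linarith
  constructor <;> linarith [(hle j).1, (hle j).2]

theorem card_bichromatic_ge {t : V → Fin r} (hr : 0 < r) {m : ℕ}
    (ht : ∀ j, #{v | t v = j} = m ∨ #{v | t v = j} = m + 1) :
    (1 - 1 / (r : ℝ)) * (Fintype.card V : ℝ) ^ 2 - Fintype.card V ≤
      #{e : V × V | t e.1 ≠ t e.2} := by
  have h1 := card_sameColour_add t
  have h2 : ∑ j, (#{v | t v = j} : ℝ) ^ 2 ≤
      ∑ j, ((Fintype.card V : ℝ) / r + 1) * (#{v | t v = j} : ℝ) := by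
    refine sum_le_sum fun j _ => ?_
    rw [sq]
    exact mul_le_mul_of_nonneg_right (balanced_card_mem hr ht j).2 (Nat.cast_nonneg _)
  rw [← mul_sum, sum_card_colour] at h2
  have h3 : (1 - 1 / (r : ℝ)) * (Fintype.card V : ℝ) ^ 2 - Fintype.card V =
    (Fintype.card V : ℝ) ^ 2 - (Fintype.card V / r + 1) * Fintype.card V := by ring
  linarith

/-- If nearly as many pairs as possible are bichromatic, then the colouring is nearly balanced. -/
theorem card_colour_ge (hr : 0 < r) {p : V → Fin r} {θ : ℝ} (hθ : 0 ≤ θ)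
    (hp : (1 - 1 / (r : ℝ) - θ ^ 2) * (Fintype.card V : ℝ) ^ 2 ≤
      #{e : V × V | p e.1 ≠ p e.2}) (j : Fin r) :
    (Fintype.card V : ℝ) / r - θ * Fintype.card V ≤ #{v | p v = j} := by
  have hr' : (0 : ℝ) < r := by exact_mod_cast hr
  have h1 := card_sameColour_add p
  have h2 : ∑ j, ((Fintype.card V : ℝ) / r - #{v | p v = j}) ^ 2 =
      ∑ j, (#{v | p v = j} : ℝ) ^ 2 - (Fintype.card V : ℝ) ^ 2 / r := by
    have : ∀ j, ((Fintype.card V : ℝ) / r - #{v | p v = j}) ^ 2 = (Fintype.card V : ℝ) ^ 2 / r ^ 2 -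
        2 * (Fintype.card V : ℝ) / r * #{v | p v = j} + (#{v | p v = j} : ℝ) ^ 2 := fun j => by ring
    rw [sum_congr rfl fun j _ => this j, sum_add_distrib, sum_sub_distrib, ← mul_sum,
      sum_card_colour, sum_const, card_univ, Fintype.card_fin, nsmul_eq_mul]
    field_simp
    ring
  have h3 : ((Fintype.card V : ℝ) / r - #{v | p v = j}) ^ 2 ≤
      ∑ j, ((Fintype.card V : ℝ) / r - #{v | p v = j}) ^ 2 :=
    single_le_sum (f := fun j => ((Fintype.card V : ℝ) / r - #{v | p v = j}) ^ 2)
      (fun j _ => sq_nonneg _) (mem_univ j)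
  have h4 : ((Fintype.card V : ℝ) / r - #{v | p v = j}) ^ 2 ≤ (θ * Fintype.card V) ^ 2 := by
    have : (1 - 1 / (r : ℝ) - θ ^ 2) * (Fintype.card V : ℝ) ^ 2 = (Fintype.card V : ℝ) ^ 2 -
      (Fintype.card V : ℝ) ^ 2 / r - (θ * Fintype.card V) ^ 2 := by ring
    linarith
  linarith [abs_le_of_sq_le_sq' h4 (by positivity)]

variable (H : SimpleGraph V)

theorem card_adj_add_missing (p : V → Fin r) :
    #{e : V × V | H.Adj e.1 e.2} + #{e : V × V | p e.1 ≠ p e.2 ∧ ¬ H.Adj e.1 e.2} =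
      #(badPairs H p) + #{e : V × V | p e.1 ≠ p e.2} := by
  have h1 := card_filter_add_card_filter_not (s := {e : V × V | H.Adj e.1 e.2})
    fun e => p e.1 = p e.2
  have h2 := card_filter_add_card_filter_not (s := {e : V × V | p e.1 ≠ p e.2})
    fun e => H.Adj e.1 e.2
  have h3 : #{e ∈ ({e : V × V | H.Adj e.1 e.2} : Finset _) | p e.1 = p e.2} = #(badPairs H p) := by
    rw [filter_filter, badPairs]
    congr!
  have h4 : #{e ∈ ({e : V × V | H.Adj e.1 e.2} : Finset _) | ¬ p e.1 = p e.2} =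
      #{e ∈ ({e : V × V | p e.1 ≠ p e.2} : Finset _) | H.Adj e.1 e.2} := by
    rw [filter_filter, filter_filter]
    simp only [and_comm, ne_eq]
  rw [filter_filter (fun e : V × V => p e.1 ≠ p e.2)] at h2
  rw [filter_filter (fun e : V × V => p e.1 ≠ p e.2)] at h2 h4
  omega

theorem mem_badPairs {p : V → Fin r} {e : V × V} :
    e ∈ badPairs H p ↔ H.Adj e.1 e.2 ∧ p e.1 = p e.2 := by
  simp [badPairs]

theorem card_badPairs_eq (p : V → Fin r) (x : V) :
    #(badPairs H p) = #{e ∈ badPairs H p | e.1 ≠ x ∧ e.2 ≠ x} +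
      2 * #{y | H.Adj x y ∧ p y = p x} := by
  have h1 : #{y | H.Adj x y ∧ p y = p x} = #{e ∈ badPairs H p | e.1 = x} := by
    refine card_bij (fun y _ => (x, y)) ?_ ?_ ?_
    · intro y hy
      simp only [mem_filter, mem_univ, true_and] at hy
      simp [mem_badPairs, hy.1, hy.2]
    · intro a _ b _ h; simpa using h
    · rintro ⟨a, b⟩ he
      simp only [mem_filter, mem_badPairs] at he
      obtain ⟨⟨h1, h2⟩, rfl⟩ := he
      exact ⟨b, by simp [h1, h2], rfl⟩
  have h2 : #{y | H.Adj x y ∧ p y = p x} = #{e ∈ badPairs H p | ¬ e.1 = x ∧ e.2 = x} := by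
    refine card_bij (fun y _ => (y, x)) ?_ ?_ ?_
    · intro y hy
      simp only [mem_filter, mem_univ, true_and] at hy
      simp [mem_badPairs, hy.1.symm, hy.2, hy.1.ne']
    · intro a _ b _ h; simpa using h
    · rintro ⟨a, b⟩ he
      simp only [mem_filter, mem_badPairs] at he
      obtain ⟨⟨hadj, h2⟩, h3, rfl⟩ := he
      exact ⟨a, by simp [hadj.symm, h2], rfl⟩
  have h3 := card_filter_add_card_filter_not (s := badPairs H p) fun e => e.1 = x
  have h4 := card_filter_add_card_filter_not (s := {e ∈ badPairs H p | ¬ e.1 = x})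
    fun e => e.2 = x
  rw [filter_filter, filter_filter] at h4
  simp only [ne_eq]
  omega

/-- In an optimal colouring every vertex has at least as many neighbours in each class as in its
own. -/
theorem card_nbrs_le_of_minimal {p : V → Fin r}
    (hmin : ∀ p' : V → Fin r, #(badPairs H p) ≤ #(badPairs H p')) (x : V) (j : Fin r) :
    #{y | H.Adj x y ∧ p y = p x} ≤ #{y | H.Adj x y ∧ p y = j} := by
  have h1 := hmin (Function.update p x j)
  rw [card_badPairs_eq H p x, card_badPairs_eq H (Function.update p x j) x] at h1
  have h2 : ({e ∈ badPairs H (Function.update p x j) | e.1 ≠ x ∧ e.2 ≠ x} : Finset _) =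
      {e ∈ badPairs H p | e.1 ≠ x ∧ e.2 ≠ x} := by
    ext e
    simp only [mem_filter, mem_badPairs]
    refine and_congr_left fun h => ?_
    rw [Function.update_of_ne h.1, Function.update_of_ne h.2]
  have h3 : ({y | H.Adj x y ∧ Function.update p x j y = Function.update p x j x} : Finset V) =
      ({y | H.Adj x y ∧ p y = j} : Finset V) := by
    ext y
    simp only [mem_filter, mem_univ, true_and, Function.update_self]
    refine and_congr_right fun h => ?_
    rw [Function.update_of_ne h.ne']
  rw [h2, h3] at h1
  omega

theorem exists_minimal_badPairs [Nonempty (V → Fin r)] :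
    ∃ p : V → Fin r, ∀ p' : V → Fin r, #(badPairs H p) ≤ #(badPairs H p') := by
  obtain ⟨p, -, hp⟩ := exists_min_image (univ : Finset (V → Fin r)) (fun p => #(badPairs H p))
    univ_nonempty
  exact ⟨p, fun p' => hp p' (mem_univ _)⟩

/-- If bad degrees are small and missing pairs are few, most bad pairs have both ends missing few
neighbours. -/
theorem card_badPairs_sub_le {p : V → Fin r} {δ : ℝ}
    (hdeg : ∀ x, (#{y | H.Adj x y ∧ p y = p x} : ℝ) ≤ δ / 2 * Fintype.card V) :
    (#(badPairs H p) : ℝ) - #{e : V × V | p e.1 ≠ p e.2 ∧ ¬ H.Adj e.1 e.2} ≤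
      #{e ∈ badPairs H p | (#{w | p e.1 ≠ p w ∧ ¬ H.Adj e.1 w} : ℝ) ≤ δ * Fintype.card V ∧
        (#{w | p e.2 ≠ p w ∧ ¬ H.Adj e.2 w} : ℝ) ≤ δ * Fintype.card V} := by
  set P : V → Prop := fun x => (#{w | p x ≠ p w ∧ ¬ H.Adj x w} : ℝ) ≤ δ * Fintype.card V
  have h1 : (#{x | ¬ P x} : ℝ) * (δ * Fintype.card V) ≤
      #{e : V × V | p e.1 ≠ p e.2 ∧ ¬ H.Adj e.1 e.2} := by
    have h2 : #{e : V × V | p e.1 ≠ p e.2 ∧ ¬ H.Adj e.1 e.2} =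
        ∑ x, #{w | p x ≠ p w ∧ ¬ H.Adj x w} := by
      rw [card_eq_sum_card_fiberwise (f := fun e : V × V => e.1) (t := univ)
        fun _ _ => mem_coe.2 (mem_univ _)]
      refine sum_congr rfl fun x _ => ?_
      symm
      refine card_bij (fun y _ => (x, y)) ?_ ?_ ?_
      · intro y hy
        simpa using hy
      · intro a _ b _ h; simpa using h
      · rintro ⟨a, b⟩ he
        simp only [mem_filter, mem_univ, true_and] at he
        obtain ⟨h1, rfl⟩ := he
        exact ⟨b, by simpa using h1, rfl⟩
    rw [h2]
    push_cast
    calc (#{x | ¬ P x} : ℝ) * (δ * Fintype.card V) =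
          ∑ _x ∈ ({x | ¬ P x} : Finset V), δ * (Fintype.card V : ℝ) := by
          rw [sum_const, nsmul_eq_mul]
      _ ≤ ∑ x ∈ ({x | ¬ P x} : Finset V), (#{w | p x ≠ p w ∧ ¬ H.Adj x w} : ℝ) :=
          sum_le_sum fun x hx => (not_le.1 (mem_filter.1 hx).2).le
      _ ≤ _ := sum_le_sum_of_subset_of_nonneg (subset_univ _) fun _ _ _ => Nat.cast_nonneg _
  have h3 : ∀ x, (#{e ∈ badPairs H p | e.1 = x} : ℝ) ≤ δ / 2 * Fintype.card V ∧
      (#{e ∈ badPairs H p | e.2 = x} : ℝ) ≤ δ / 2 * Fintype.card V := by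
    intro x
    constructor <;> refine le_trans ?_ (hdeg x) <;> norm_cast
    · refine card_le_card_of_injOn Prod.snd ?_ ?_
      · rintro ⟨a, b⟩ he
        simp only [mem_coe, mem_filter, mem_badPairs] at he
        obtain ⟨⟨h1, h2⟩, rfl⟩ := he
        simp [h1, h2]
      · rintro ⟨a, b⟩ he ⟨a', b'⟩ he' h
        simp only [mem_coe, mem_filter] at he he' h
        simp [he.2, he'.2, h]
    · refine card_le_card_of_injOn Prod.fst ?_ ?_
      · rintro ⟨a, b⟩ he
        simp only [mem_coe, mem_filter, mem_badPairs] at he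
        obtain ⟨⟨h1, h2⟩, rfl⟩ := he
        simp [h1.symm, h2]
      · rintro ⟨a, b⟩ he ⟨a', b'⟩ he' h
        simp only [mem_coe, mem_filter] at he he' h
        simp [he.2, he'.2, h]
  have h4 : badPairs H p ⊆ {e ∈ badPairs H p | P e.1 ∧ P e.2} ∪
      (({x | ¬ P x} : Finset V).biUnion (fun x => {e ∈ badPairs H p | e.1 = x}) ∪
        ({x | ¬ P x} : Finset V).biUnion fun x => {e ∈ badPairs H p | e.2 = x}) := by
    intro e he
    simp only [mem_union, mem_filter, mem_biUnion, mem_univ, true_and, he]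
    by_cases h1 : P e.1
    · by_cases h2 : P e.2
      · exact Or.inl ⟨h1, h2⟩
      · exact Or.inr (Or.inr ⟨_, h2, rfl⟩)
    · exact Or.inr (Or.inl ⟨_, h1, rfl⟩)
  have h5 : (#(badPairs H p) : ℝ) ≤ #{e ∈ badPairs H p | P e.1 ∧ P e.2} +
      (∑ x ∈ ({x | ¬ P x} : Finset V), (#{e ∈ badPairs H p | e.1 = x} : ℝ) +
        ∑ x ∈ ({x | ¬ P x} : Finset V), (#{e ∈ badPairs H p | e.2 = x} : ℝ)) := by
    norm_cast
    refine (card_le_card h4).trans ((card_union_le _ _).trans (Nat.add_le_add_left ?_ _))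
    exact (card_union_le _ _).trans (add_le_add card_biUnion_le card_biUnion_le)
  have h6 : ∑ x ∈ ({x | ¬ P x} : Finset V), (#{e ∈ badPairs H p | e.1 = x} : ℝ) ≤
      #{x | ¬ P x} * (δ / 2 * Fintype.card V) := by
    refine (sum_le_sum fun x _ => (h3 x).1).trans_eq ?_
    rw [sum_const, nsmul_eq_mul]
  have h7 : ∑ x ∈ ({x | ¬ P x} : Finset V), (#{e ∈ badPairs H p | e.2 = x} : ℝ) ≤
      #{x | ¬ P x} * (δ / 2 * Fintype.card V) := by
    refine (sum_le_sum fun x _ => (h3 x).2).trans_eq ?_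
    rw [sum_const, nsmul_eq_mul]
  linarith

end Cuts

section Assembly

variable {α V : Type} [Fintype α] [Fintype V] [Nonempty V] {F : SimpleGraph α} {r : ℕ}

/-- If every vertex lies in few embeddings of `F`, then there are few cliques. -/
theorem orderedCliques_pow_le_of_through_le [Nonempty α] {k : ℕ} (χ : F.Coloring (Fin k))
    {H : SimpleGraph V} {T : ℝ}
    (hT : ∀ x, (#{φ ∈ embeddings F H | ∃ w, φ w = x} : ℝ) ≤ T) :
    (#(orderedCliques H k) / (Fintype.card V : ℝ) ^ k) ^ Fintype.card α ^ k ≤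
      Fintype.card V * T / (Fintype.card V : ℝ) ^ Fintype.card α +
        (Fintype.card α : ℝ) ^ 2 * (Fintype.card V / (Fintype.card V : ℝ) ^ 2) := by
  have hN : (0 : ℝ) < Fintype.card V := by exact_mod_cast Fintype.card_pos
  have h1 := density_clique_pow_le_density_hom F χ H
  have h2 : density (fun t : Fin k → V => ∀ i j, i ≠ j → H.Adj (t i) (t j)) =
      #(orderedCliques H k) / (Fintype.card V : ℝ) ^ k := by
    rw [density, orderedCliques, Fintype.card_fun, Fintype.card_fin]
    push_cast
    congr!
  have h3 : (#(embeddings F H) : ℝ) ≤ Fintype.card V * T := by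
    have h4 : embeddings F H ⊆ (univ : Finset V).biUnion fun x =>
        {φ ∈ embeddings F H | ∃ w, φ w = x} := by
      intro φ hφ
      simp only [mem_biUnion, mem_univ, true_and, mem_filter]
      exact ⟨φ (Classical.arbitrary α), hφ, _, rfl⟩
    have h5 : (#(embeddings F H) : ℝ) ≤
        ∑ x : V, (#{φ ∈ embeddings F H | ∃ w, φ w = x} : ℝ) := by
      exact_mod_cast (card_le_card h4).trans card_biUnion_le
    refine h5.trans ((sum_le_sum fun x _ => hT x).trans_eq ?_)
    rw [sum_const, card_univ, nsmul_eq_mul]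
  obtain ⟨B, hB, hBcard⟩ : ∃ B : Finset (α → V), (∀ φ, φ ∈ B ↔ ¬ Function.Injective φ) ∧
      (#B : ℝ) ≤ (Fintype.card α : ℝ) ^ 2 * (Fintype.card V / (Fintype.card V : ℝ) ^ 2 *
        (Fintype.card V : ℝ) ^ Fintype.card α) := ⟨_, by simp, card_not_injective_le⟩
  have h6 : (#{φ : α → V | ∀ ⦃u v⦄, F.Adj u v → H.Adj (φ u) (φ v)} : ℝ) ≤
      #(embeddings F H) + #B := by
    norm_cast
    refine (card_le_card fun φ hφ => ?_).trans (card_union_le _ _)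
    rw [mem_union, mem_embeddings, hB]
    have := (mem_filter.1 hφ).2
    tauto
  rw [h2] at h1
  refine h1.trans ?_
  have h7 : density (fun φ : α → V => ∀ ⦃u v⦄, F.Adj u v → H.Adj (φ u) (φ v)) =
      #{φ : α → V | ∀ ⦃u v⦄, F.Adj u v → H.Adj (φ u) (φ v)} /
        (Fintype.card V : ℝ) ^ Fintype.card α := by
    rw [density, Fintype.card_fun]
    push_cast
    congr!
  rw [h7, div_add' _ _ _ (by positivity)]
  gcongr
  linarith

theorem through_error_eq {N : ℝ} (hN : N ≠ 0) (f η W : ℝ) :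
    f ^ 2 * ((N + η * N ^ 2) / N ^ 3 * (N ^ 2 * W)) = f ^ 2 * (1 / N + η) * (N * W) := by
  field_simp

theorem edge_error_eq {N : ℝ} (hN : N ≠ 0) (f δ η r s W : ℝ) :
    f ^ 2 * (f ^ 2 * (((δ * N + r * (s * N)) / N ^ 3 +
      (η * N ^ 2 + 2 * (N * (r * (s * N)))) / N ^ 4) * (N ^ 2 * W))) =
      f ^ 4 * (δ + η + 3 * r * s) * W := by
  field_simp
  ring

set_option maxHeartbeats 1000000 in
theorem vertex_or_good_pairs_of_bounds (hr : 2 ≤ r) (hF : ¬ F.Colorable r)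
    (χ₁ : F.Coloring (Fin (r + 1))) {χ : α → Fin r} {a b : α} (hχ : IsAlmostColouring F χ a b)
    {k : ℕ} (hk : 1 ≤ k) (hcard : Fintype.card α = k + 2) {A ε f c₁ δ θ η ς τ : ℝ} (hA : 0 ≤ A)
    (hε : 0 < ε) (hf : f = Fintype.card α) (hc₁ : c₁ = (1 / (2 * (r : ℝ))) ^ k)
    (hδ : 0 < δ) (hθ : 0 < θ) (hς : 0 < ς) (hτ : 0 < τ)
    (hstab : ∀ G : SimpleGraph V,
      (1 - 1 / (r : ℝ) - ς) * (Fintype.card V : ℝ) ^ 2 ≤ #{p : V × V | G.Adj p.1 p.2} →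
      (#(orderedCliques G (r + 1)) : ℝ) ≤ ς * (Fintype.card V : ℝ) ^ (r + 1) →
      ∃ p : V → Fin r, (#(badPairs G p) : ℝ) ≤ η * (Fintype.card V : ℝ) ^ 2)
    (b₁ : (2 * f ^ 2 + A) * τ ≤ c₁ / 2) (b₂ : 2 * f ^ 2 * τ < ς ^ Fintype.card α ^ (r + 1))
    (b₃ : τ ≤ ς) (b₄ : τ + η ≤ θ ^ 2) (b₅ : f ^ 2 * (2 * τ + η) ≤ (δ / 2) ^ (k + 1))
    (b₆ : 3 * r * τ ≤ 1) (b₇ : A * τ + f ^ 4 * (δ + η + 3 * r * (θ + τ)) ≤ ε * (c₁ / 2))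
    {t : V → Fin r} {m : ℕ} (ht : ∀ j, #{v | t v = j} = m ∨ #{v | t v = j} = m + 1)
    (hN1 : 1 ≤ τ * Fintype.card V) {q c : ℝ} (hq0 : 0 ≤ q) (hq : q ≤ τ * Fintype.card V)
    (hc : ∀ u v, u ≠ v → t u = t v → c ≤ #(embeddings F (multipartitePlus t u v)))
    (hc' : ∃ u v, u ≠ v ∧ t u = t v ∧ (#(embeddings F (multipartitePlus t u v)) : ℝ) ≤ c + A)
    {H : SimpleGraph V}
    (hH : (#{e : V × V | H.Adj e.1 e.2} : ℝ) = #{e : V × V | t e.1 ≠ t e.2} + 2 * q) :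
    (∃ x, q * c ≤ #{φ ∈ embeddings F H | ∃ w, φ w = x}) ∨
    ∃ E : Finset (V × V), 2 * q ≤ #E ∧ ∀ e ∈ E, H.Adj e.1 e.2 ∧ (1 - ε) * c + A ≤
      #{φ ∈ embeddings F H | ∃ w z, F.Adj w z ∧ s(φ w, φ z) = s(e.1, e.2)} := by
  have hN : (0 : ℝ) < Fintype.card V := by exact_mod_cast Fintype.card_pos
  have hr0 : (0 : ℝ) < r := by exact_mod_cast (by omega : 0 < r)
  have hf0 : 0 ≤ f := by rw [hf]; positivity
  have hbal := balanced_card_mem (by omega) ht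
  have hKt := card_bichromatic_ge (by omega) ht
  have hKp := card_bichromatic_le ht
  have hlow := fun (g : ℝ) (hg : 0 ≤ g) (hgt : ∀ j, g ≤ #{v | t v = j}) (u v : V)
    (huv : u ≠ v) (htuv : t u = t v) => card_embeddings_multipartitePlus_ge hχ hg hgt huv htuv
  have hupp := fun u v => card_embeddings_multipartitePlus_le hF t u v
  have hthr := fun (p : V → Fin r) (x : V) (g m : ℝ) (hg : 0 ≤ g)
    (hx : ∀ j, g ≤ #{y | H.Adj x y ∧ p y = j}) hm =>
      card_embeddings_through_ge (m := m) hχ hg hx hm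
  have hcl := fun (T : ℝ) hT => haveI : Nonempty α := ⟨a⟩
    orderedCliques_pow_le_of_through_le (T := T) χ₁ (H := H) hT
  have hedge := fun (p : V → Fin r) (D : ℕ) hD (u v x y : V) huv hu hv hxy hp (d m : ℝ) hx hy hm =>
    card_embeddings_edge_ge hF (H := H) (t := t) (p := p) (D := D) hD (u := u) (v := v) (x := x)
      (y := y) huv hu hv hxy hp (d := d) (m := m) hx hy hm
  have hdegs := fun p : V → Fin r => card_badPairs_sub_le H (p := p) (δ := δ)
  have hadd : ∀ p : V → Fin r, (#{e : V × V | H.Adj e.1 e.2} : ℝ) +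
      #{e : V × V | p e.1 ≠ p e.2 ∧ ¬ H.Adj e.1 e.2} =
      #(badPairs H p) + #{e : V × V | p e.1 ≠ p e.2} := fun p => by
    exact_mod_cast card_adj_add_missing H p
  have hcol := fun (p : V → Fin r) => card_colour_ge (by omega) (p := p) hθ.le
  have hW : (0 : ℝ) < (Fintype.card V : ℝ) ^ k := by positivity
  have hpow : (Fintype.card V : ℝ) ^ Fintype.card α =
      (Fintype.card V : ℝ) ^ 2 * (Fintype.card V : ℝ) ^ k := by rw [hcard]; ring
  have hk2 : Fintype.card α - 2 = k := by omega
  have hk1 : Fintype.card α - 1 = k + 1 := by omega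
  simp only [hpow, hk2, ← hf] at hlow hupp hthr hcl hedge
  simp only [hk1] at hthr
  set N : ℝ := (Fintype.card V : ℝ) with hNdef
  set W : ℝ := N ^ k with hWdef
  have hN3 : 3 * r ≤ N := by nlinarith
  have hNr : 2 ≤ N / r - 1 := by
    rw [le_sub_iff_add_le, le_div_iff₀ hr0]; linarith
  have hNW : N ≤ W := by
    refine le_self_pow₀ ?_ (by omega)
    have : (2 : ℝ) ≤ r := by exact_mod_cast hr
    linarith
  have hinv : 1 / N ≤ τ := by rwa [div_le_iff₀ hN]
  have hAW : A ≤ A * τ * W := by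
    calc A = A * 1 := by ring
      _ ≤ A * (τ * N) := by gcongr
      _ ≤ A * (τ * W) := by gcongr
      _ = _ := by ring
  have hclow : c₁ / 2 * W ≤ c := by
    obtain ⟨u, v, huv, htuv, hcuv⟩ := hc'
    have h1 := hlow (N / (2 * r)) (by positivity) (fun j => le_trans ?_ (hbal j).1) u v huv htuv
    · have h2 : (N / (2 * r)) ^ k = c₁ * W := by
        rw [hc₁, hWdef, ← mul_pow]; congr 1; ring
      have h3 : f ^ 2 * ((1 / N ^ 3 + N / N ^ 4) * (N ^ 2 * W)) = 2 * f ^ 2 * (1 / N) * W := by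
        field_simp
        ring
      have h4 : 2 * f ^ 2 * (1 / N) * W ≤ 2 * f ^ 2 * τ * W := by gcongr
      rw [h2, h3] at h1
      have h5 := mul_le_mul_of_nonneg_right b₁ hW.le
      linarith
    · have h2 : N / (2 * r) = N / r / 2 := by field_simp
      rw [h2]
      linarith
  have hcup : c ≤ f ^ 2 * W := by
    obtain ⟨u, v, huv, htuv, -⟩ := hc'
    refine (hc u v huv htuv).trans ((hupp u v).trans_eq ?_)
    field_simp
  have hc0 : 0 ≤ c := le_trans (by rw [hc₁]; positivity) hclow
  by_cases hx : ∃ x, q * c ≤ #{φ ∈ embeddings F H | ∃ w, φ w = x}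
  · exact Or.inl hx
  right
  push Not at hx
  have hqc : q * c ≤ τ * N * (f ^ 2 * W) := by gcongr
  have hxs := fun x => (hx x).le.trans hqc
  replace hx := fun x => (hx x).trans_le hqc
  have hη0 : ∃ p : V → Fin r, (#(badPairs H p) : ℝ) ≤ η * N ^ 2 := by
    refine hstab H ?_ ?_
    · have h1 : N ≤ ς * N ^ 2 := by nlinarith
      rw [hH]
      linarith
    · have h1 := hcl _ hxs
      have h2 : N * (τ * N * (f ^ 2 * W)) / (N ^ 2 * W) + f ^ 2 * (N / N ^ 2) =
          f ^ 2 * τ + f ^ 2 * (1 / N) := by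
        field_simp
      have h3 : f ^ 2 * (1 / N) ≤ f ^ 2 * τ := by gcongr
      have h4 : (#(orderedCliques H (r + 1)) / N ^ (r + 1)) ^ Fintype.card α ^ (r + 1) <
          ς ^ Fintype.card α ^ (r + 1) := by linarith
      have h5 := (lt_of_pow_lt_pow_left₀ _ hς.le h4).le
      rwa [div_le_iff₀ (by positivity)] at h5
  have hneV : Nonempty (V → Fin r) := ⟨fun _ => ⟨0, by omega⟩⟩
  obtain ⟨p, hpmin⟩ := exists_minimal_badPairs (r := r) H
  have hbad : (#(badPairs H p) : ℝ) ≤ η * N ^ 2 := by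
    obtain ⟨p₀, hp₀⟩ := hη0
    exact le_trans (by exact_mod_cast hpmin p₀) hp₀
  have hsum := hadd p
  have hKpp := hKp p
  obtain ⟨M, hM⟩ : ∃ M : ℝ, M = #{e : V × V | p e.1 ≠ p e.2 ∧ ¬ H.Adj e.1 e.2} := ⟨_, rfl⟩
  have hM0 : 0 ≤ M := hM ▸ Nat.cast_nonneg _
  rw [← hM, hH] at hsum
  have hMbad : M + 2 * q ≤ #(badPairs H p) := by linarith
  have hMη : M ≤ η * N ^ 2 := by linarith
  have hNN : N ≤ τ * N ^ 2 := by nlinarith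
  have hclass := hcol p (by
    have : (τ + η) * N ^ 2 ≤ θ ^ 2 * N ^ 2 := by gcongr
    linarith)
  by_cases hdeg : ∀ x, (#{y | H.Adj x y ∧ p y = p x} : ℝ) ≤ δ / 2 * N
  swap
  · exfalso
    push Not at hdeg
    obtain ⟨x, hxd⟩ := hdeg
    have h1 := hthr p x (δ / 2 * N) (η * N ^ 2) (by positivity)
      (fun j => hxd.le.trans (by exact_mod_cast card_nbrs_le_of_minimal H hpmin x j))
      (hM ▸ hMη)
    have h2 := hx x
    have h3 : (δ / 2 * N) ^ (k + 1) = (δ / 2) ^ (k + 1) * (N * W) := by rw [hWdef]; ring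
    have h4 := through_error_eq hN.ne' f η W
    have h5 : f ^ 2 * (1 / N + η) * (N * W) ≤ f ^ 2 * (τ + η) * (N * W) := by gcongr
    have h6 : f ^ 2 * (2 * τ + η) * (N * W) ≤ (δ / 2) ^ (k + 1) * (N * W) := by gcongr
    rw [h3, h4] at h1
    linarith
  have hgood := hdegs p hdeg
  rw [← hM] at hgood
  refine ⟨_, le_trans (by linarith) hgood, fun e he => ?_⟩
  rw [mem_filter, mem_badPairs] at he
  obtain ⟨⟨hadj, hpe⟩, he1, he2⟩ := he
  refine ⟨hadj, ?_⟩
  have hDle : (⌊θ * N + 1⌋₊ : ℝ) ≤ (θ + τ) * N := by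
    refine (Nat.floor_le (by positivity)).trans ?_
    linarith
  have hD : ∀ j, #{v | t v = j} ≤ #{v | p v = j} + ⌊θ * N + 1⌋₊ := fun j => by
    have h1 : (#{v | t v = j} : ℝ) - #{v | p v = j} ≤ θ * N + 1 := by
      linarith [(hbal j).2, hclass j]
    have h2 : ((#{v | t v = j} - #{v | p v = j} : ℕ) : ℝ) ≤ θ * N + 1 := by
      rcases le_total #{v | p v = j} #{v | t v = j} with h | h
      · rwa [Nat.cast_sub h]
      · rw [Nat.sub_eq_zero_of_le h]
        push_cast
        positivity
    have := Nat.le_floor h2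
    omega
  obtain ⟨u, hu, v, hv, huv⟩ : ∃ u ∈ ({v | t v = p e.1} : Finset V),
      ∃ v ∈ ({v | t v = p e.1} : Finset V), u ≠ v := by
    refine one_lt_card.1 ?_
    have := (hbal (p e.1)).1
    have h2 : (2 : ℝ) ≤ #{v | t v = p e.1} := by linarith
    have h3 : 2 ≤ #{v | t v = p e.1} := by exact_mod_cast h2
    omega
  rw [mem_filter] at hu hv
  have h1 := hedge p _ hD u v e.1 e.2 huv hu.2 (hv.2.trans hpe) hadj hpe (δ * N) (η * N ^ 2)
    he1 he2 (hM ▸ hMη)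
  have h2 := hc u v huv (hu.2.trans hv.2.symm)
  set D : ℝ := (⌊θ * N + 1⌋₊ : ℝ) with hDdef
  have h3 : f ^ 2 * (f ^ 2 * (((δ * N + r * D) / N ^ 3 +
      (η * N ^ 2 + 2 * (N * (r * D))) / N ^ 4) * (N ^ 2 * W))) ≤
      f ^ 2 * (f ^ 2 * (((δ * N + r * ((θ + τ) * N)) / N ^ 3 +
      (η * N ^ 2 + 2 * (N * (r * ((θ + τ) * N)))) / N ^ 4) * (N ^ 2 * W))) := by gcongr
  have h4 := edge_error_eq hN.ne' f δ η r (θ + τ) W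
  have h5 := mul_le_mul_of_nonneg_right b₇ hW.le
  have h6 : ε * (c₁ / 2 * W) ≤ ε * c := by gcongr
  linarith

end Assembly

section Constants

variable {α : Type} [Fintype α] {F : SimpleGraph α} {r : ℕ}

theorem eventually_mul_lt (K : ℝ) {g : ℝ} (hg : 0 < g) : ∀ᶠ τ in nhdsWithin (0 : ℝ) (Set.Ioi 0),
    K * τ < g := by
  have h : Filter.Tendsto (fun τ : ℝ => K * τ) (nhds 0) (nhds (K * 0)) :=
    (continuous_const_mul K).tendsto 0
  rw [mul_zero] at h
  exact (h.mono_left nhdsWithin_le_nhds).eventually (gt_mem_nhds hg)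

/-- The main dichotomy for embeddings, in a graph with `q` more edges than a balanced complete
multipartite graph. -/
theorem exists_vertex_or_good_pairs (hr : 2 ≤ r) (hF : ¬ F.Colorable r)
    (χ₁ : F.Coloring (Fin (r + 1))) {χ : α → Fin r} {a b : α} (hχ : IsAlmostColouring F χ a b)
    (hcard : 3 ≤ Fintype.card α) {A ε : ℝ} (hA : 0 ≤ A) (hε : 0 < ε) :
    ∃ τ : ℝ, 0 < τ ∧ ∀ {V : Type} [Fintype V] [Nonempty V] {t : V → Fin r} {m : ℕ},
    (∀ j, #{v | t v = j} = m ∨ #{v | t v = j} = m + 1) → 1 ≤ τ * Fintype.card V →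
    ∀ {q c : ℝ}, 0 ≤ q → q ≤ τ * Fintype.card V →
    (∀ u v, u ≠ v → t u = t v → c ≤ #(embeddings F (multipartitePlus t u v))) →
    (∃ u v, u ≠ v ∧ t u = t v ∧ (#(embeddings F (multipartitePlus t u v)) : ℝ) ≤ c + A) →
    ∀ {H : SimpleGraph V},
    (#{e : V × V | H.Adj e.1 e.2} : ℝ) = #{e : V × V | t e.1 ≠ t e.2} + 2 * q →
    (∃ x, q * c ≤ #{φ ∈ embeddings F H | ∃ w, φ w = x}) ∨
    ∃ E : Finset (V × V), 2 * q ≤ #E ∧ ∀ e ∈ E, H.Adj e.1 e.2 ∧ (1 - ε) * c + A ≤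
      #{φ ∈ embeddings F H | ∃ w z, F.Adj w z ∧ s(φ w, φ z) = s(e.1, e.2)} := by
  obtain ⟨k, hk⟩ : ∃ k, Fintype.card α = k + 2 := ⟨Fintype.card α - 2, by omega⟩
  obtain ⟨f, hf⟩ : ∃ f : ℝ, f = Fintype.card α := ⟨_, rfl⟩
  have hf0 : 0 < f := by rw [hf]; exact_mod_cast (by omega : 0 < Fintype.card α)
  have hr0 : (0 : ℝ) < r := by exact_mod_cast (by omega : 0 < r)
  obtain ⟨c₁, hc₁⟩ : ∃ c₁ : ℝ, c₁ = (1 / (2 * (r : ℝ))) ^ k := ⟨_, rfl⟩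
  have hc₁0 : 0 < c₁ := by rw [hc₁]; positivity
  obtain ⟨e, he⟩ : ∃ e : ℝ, e = ε * (c₁ / 2) := ⟨_, rfl⟩
  have he0 : 0 < e := by rw [he]; positivity
  obtain ⟨δ, hδ⟩ : ∃ δ : ℝ, δ = e / (8 * f ^ 4) := ⟨_, rfl⟩
  have hδ0 : 0 < δ := by rw [hδ]; positivity
  obtain ⟨θ, hθ⟩ : ∃ θ : ℝ, θ = e / (24 * r * f ^ 4) := ⟨_, rfl⟩
  have hθ0 : 0 < θ := by rw [hθ]; positivity
  obtain ⟨η, hη0, hη1, hη2, hη3⟩ : ∃ η : ℝ, 0 < η ∧ η ≤ e / (8 * f ^ 4) ∧ η ≤ θ ^ 2 / 2 ∧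
      η ≤ (δ / 2) ^ (k + 1) / (2 * f ^ 2) :=
    ⟨min (e / (8 * f ^ 4)) (min (θ ^ 2 / 2) ((δ / 2) ^ (k + 1) / (2 * f ^ 2))),
      by positivity, min_le_left _ _, (min_le_right _ _).trans (min_le_left _ _),
      (min_le_right _ _).trans (min_le_right _ _)⟩
  obtain ⟨ς, hς0, hstab⟩ := exists_colouring_card_badPairs_le r hr hη0
  have h1 := eventually_mul_lt (2 * f ^ 2 + A) (half_pos hc₁0)
  have h2 := eventually_mul_lt (2 * f ^ 2)
    (show 0 < ς ^ Fintype.card α ^ (r + 1) by positivity)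
  have h3 := eventually_mul_lt 1 hς0
  have h4 := eventually_mul_lt 1 (show 0 < θ ^ 2 / 2 by positivity)
  have h5 := eventually_mul_lt (f ^ 2 * 2) (show 0 < (δ / 2) ^ (k + 1) / 2 by positivity)
  have h6 := eventually_mul_lt (3 * r) one_pos
  have h7 := eventually_mul_lt (A + f ^ 4 * (3 * r)) (half_pos he0)
  obtain ⟨τ, ⟨h1, h2, h3, h4, h5, h6, h7⟩, hτ⟩ := ((h1.and <| h2.and <| h3.and <| h4.and <|
    h5.and <| h6.and h7).and self_mem_nhdsWithin).exists
  refine ⟨τ, hτ, fun ht hN1 q c hq0 hq hc hc' H hH => ?_⟩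
  rw [le_div_iff₀ (by positivity)] at hη1 hη3
  have hδ' : f ^ 4 * δ = e / 8 := by rw [hδ]; field_simp
  have hθ' : f ^ 4 * (3 * r * θ) = e / 8 := by rw [hθ]; field_simp; norm_num
  exact vertex_or_good_pairs_of_bounds hr hF χ₁ hχ (by omega) hk hA hε hf hc₁ hδ0 hθ0 hς0 hτ
    (fun G => hstab G) h1.le h2 (by linarith) (by linarith) (by linarith) h6.le
    (by rw [← he]; linarith) ht hN1 hq0 hq hc hc' hH

end Constants

section Turan

variable {α : Type} [Fintype α] {F : SimpleGraph α} {r : ℕ}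

omit [Fintype α] in
theorem IsCriticalGraph.exists_isAlmostColouring (hF : IsCriticalGraph r F) :
    ¬ F.Colorable r ∧ F.Colorable (r + 1) ∧
      ∃ (χ : α → Fin r) (a b : α), IsAlmostColouring F χ a b := by
  obtain ⟨h1, e, he, h2⟩ := hF
  have hnot : ¬ F.Colorable r := by
    rw [← chromaticNumber_le_iff_colorable, h1, Nat.cast_le]
    omega
  refine ⟨hnot, chromaticNumber_le_iff_colorable.1 h1.le, ?_⟩
  obtain ⟨χ⟩ := chromaticNumber_le_iff_colorable.1 h2.le
  induction e with | _ a b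
  have hne : ∀ ⦃w z⦄, F.Adj w z → s(w, z) ≠ s(a, b) → χ w ≠ χ z := fun w z hwz hs =>
    χ.valid (by rw [deleteEdges_adj]; exact ⟨hwz, hs⟩)
  refine ⟨χ, a, b, he, ?_, hne⟩
  by_contra hab
  refine hnot ⟨Coloring.mk χ fun {w z} hwz => ?_⟩
  by_cases hs : s(w, z) = s(a, b)
  · rcases Sym2.eq_iff.1 hs with ⟨rfl, rfl⟩ | ⟨rfl, rfl⟩
    · exact hab
    · exact Ne.symm hab
  · exact hne hwz hs

theorem two_mul_ncard_edgeSet {V : Type} [Fintype V] (G : SimpleGraph V) :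
    2 * G.edgeSet.ncard = #{e : V × V | G.Adj e.1 e.2} := by
  rw [Set.ncard_eq_toFinset_card', ← edgeFinset, two_mul_card_edgeFinset]

/-- The colouring of `Fin n` by residues modulo `r`. -/
def residueColouring (hr : 0 < r) (n : ℕ) (v : Fin n) : Fin r :=
  ⟨v % r, Nat.mod_lt _ hr⟩

theorem residueColouring_eq_iff {hr : 0 < r} {n : ℕ} {u v : Fin n} :
    residueColouring hr n u = residueColouring hr n v ↔ (u : ℕ) % r = v % r := by
  simp [residueColouring]

theorem card_residueColouring_eq (hr : 0 < r) (n : ℕ) (j : Fin r) :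
    #{v | residueColouring hr n v = j} = n / r ∨
      #{v | residueColouring hr n v = j} = n / r + 1 := by
  have h1 : #{v | residueColouring hr n v = j} = n.count (· ≡ j [MOD r]) := by
    rw [Nat.count_eq_card_filter_range]
    refine card_bij (fun v _ => (v : ℕ)) ?_ ?_ ?_
    · intro v hv
      rw [mem_filter] at hv ⊢
      refine ⟨mem_range.2 v.2, ?_⟩
      rw [Nat.ModEq, ← hv.2, residueColouring, Nat.mod_mod]
    · intro u _ v _ h
      exact Fin.ext h
    · intro w hw
      rw [mem_filter, mem_range] at hw
      refine ⟨⟨w, hw.1⟩, ?_, rfl⟩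
      rw [mem_filter]
      refine ⟨mem_univ _, Fin.ext ?_⟩
      have := hw.2
      rwa [Nat.ModEq, Nat.mod_eq_of_lt j.2] at this
  rw [h1, Nat.count_modEq_card _ hr]
  split_ifs
  · exact Or.inr rfl
  · exact Or.inl rfl

theorem turanGraph_sup_eq (hr : 0 < r) {n : ℕ} (u v : Fin n) :
    turanGraph n r ⊔ fromEdgeSet {s(u, v)} = multipartitePlus (residueColouring hr n) u v := by
  rw [multipartitePlus]
  congr 1
  ext x y
  rw [turanGraph_adj, comap_adj, top_adj, Ne, Ne, residueColouring_eq_iff]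

theorem two_mul_turanEdges (hr : 0 < r) (n : ℕ) : 2 * turanEdges r n =
    #{e : Fin n × Fin n | residueColouring hr n e.1 ≠ residueColouring hr n e.2} := by
  rw [turanEdges, two_mul_ncard_edgeSet]
  congr 1
  ext e
  simp only [mem_filter, mem_univ, true_and, turanGraph_adj, Ne, residueColouring_eq_iff]

theorem natCard_automorphisms_pos : 0 < Nat.card (F ≃g F) := by
  have : Finite (F ≃g F) := Finite.of_injective (fun f : F ≃g F => (f : α → α)) DFunLike.coe_injective
  exact Nat.card_pos

theorem le_natDiv_of_mul_add_le {x : ℝ} {K A : ℕ} (hA : 0 < A) (h : x * A + A ≤ K) :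
    x ≤ (K / A : ℕ) := by
  have h1 : (K : ℝ) < (K / A : ℕ) * A + A := by exact_mod_cast Nat.lt_div_mul_add hA
  have hA' : (0 : ℝ) < A := by exact_mod_cast hA
  refine le_of_mul_le_mul_right ?_ hA'
  linarith

theorem copyCount_eq {V : Type} [Fintype V] (H : SimpleGraph V) :
    _root_.copyCount F H = #(embeddings F H) / Nat.card (F ≃g F) := by
  rw [_root_.copyCount.eq_def, natCard_embedding_subtype (V := V)
    fun φ : α → V => ∀ ⦃u v⦄, F.Adj u v → H.Adj (φ u) (φ v), embeddings]
  congr!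

theorem copyCountThrough_eq {V : Type} [Fintype V] (H : SimpleGraph V) (x : V) :
    copyCountThrough F H x =
      #{φ ∈ embeddings F H | ∃ w, φ w = x} / Nat.card (F ≃g F) := by
  rw [copyCountThrough, natCard_embedding_subtype (V := V)
    fun φ : α → V => (∀ ⦃u v⦄, F.Adj u v → H.Adj (φ u) (φ v)) ∧ ∃ u, φ u = x]
  congr 2
  ext φ
  simp only [mem_filter, mem_univ, true_and, mem_embeddings, and_assoc]

theorem copyCountOnEdge_eq {V : Type} [Fintype V] (H : SimpleGraph V) (e : Sym2 V) :
    copyCountOnEdge F H e =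
      #{φ ∈ embeddings F H | ∃ w z, F.Adj w z ∧ s(φ w, φ z) = e} / Nat.card (F ≃g F) := by
  rw [copyCountOnEdge, natCard_embedding_subtype (V := V)
    fun φ : α → V => (∀ ⦃u v⦄, F.Adj u v → H.Adj (φ u) (φ v)) ∧
      ∃ u v, F.Adj u v ∧ s(φ u, φ v) = e]
  congr 2
  ext φ
  simp only [mem_filter, mem_univ, true_and, mem_embeddings, and_assoc]

theorem critCount_mul_le (hr : 0 < r) {n : ℕ} {u v : Fin n} (huv : u ≠ v)
    (h : residueColouring hr n u = residueColouring hr n v) :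
    critCount r n F * Nat.card (F ≃g F) ≤
      #(embeddings F (multipartitePlus (residueColouring hr n) u v)) := by
  have h1 : critCount r n F ≤
      _root_.copyCount F (turanGraph n r ⊔ fromEdgeSet {s(u, v)}) :=
    Nat.sInf_le ⟨u, v, huv, residueColouring_eq_iff.1 h, rfl⟩
  rw [turanGraph_sup_eq hr, copyCount_eq] at h1
  exact (Nat.mul_le_mul_right _ h1).trans (Nat.div_mul_le_self _ _)

theorem exists_card_embeddings_le (hr : 0 < r) {n : ℕ} (hn : r < n) :
    ∃ u v : Fin n, u ≠ v ∧ residueColouring hr n u = residueColouring hr n v ∧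
      #(embeddings F (multipartitePlus (residueColouring hr n) u v)) ≤
        critCount r n F * Nat.card (F ≃g F) + Nat.card (F ≃g F) := by
  obtain ⟨u, v, huv, h, hc⟩ := Nat.sInf_mem (s := { m | ∃ u v : Fin n, u ≠ v ∧
    (u : ℕ) % r = (v : ℕ) % r ∧ m = _root_.copyCount F (turanGraph n r ⊔ fromEdgeSet {s(u, v)}) })
    ⟨_, ⟨0, by omega⟩, ⟨r, hn⟩, by simp [Fin.ext_iff]; omega, by simp, rfl⟩
  rw [← critCount.eq_def, turanGraph_sup_eq hr, copyCount_eq] at hc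
  refine ⟨u, v, huv, residueColouring_eq_iff.2 h, ?_⟩
  rw [hc]
  have := Nat.lt_div_mul_add (a := #(embeddings F (multipartitePlus (residueColouring hr n) u v)))
    (natCard_automorphisms_pos (F := F))
  omega

/-- The dichotomy for copies, when `n` is large and `q` is a small multiple of `n`. -/
theorem exists_vertex_or_edges_of_le (hr : 2 ≤ r) (hF : IsCriticalGraph r F) {ε : ℝ}
    (hε : 0 < ε) : ∃ τ : ℝ, 0 < τ ∧ ∀ n : ℕ, r < n → 1 ≤ τ * n → ∀ q : ℕ, q ≤ τ * n →
      ∀ H : SimpleGraph (Fin n), H.edgeSet.ncard = turanEdges r n + q →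
        (∃ x : Fin n, q * critCount r n F ≤ copyCountThrough F H x) ∨
        (∃ E : Finset (Sym2 (Fin n)), ↑E ⊆ H.edgeSet ∧ (1 - ε) * (q : ℝ) ≤ (E.card : ℝ) ∧
          ∀ e ∈ E, (1 - ε) * (critCount r n F : ℝ) ≤ (copyCountOnEdge F H e : ℝ)) := by
  obtain ⟨hnot, ⟨χ₁⟩, χ, a, b, hχ⟩ := hF.exists_isAlmostColouring
  have hr0 : 0 < r := by omega
  have hcard : 3 ≤ Fintype.card α := by
    by_contra h
    exact hnot (F.colorable_of_fintype.mono (by omega))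
  obtain ⟨A, hA⟩ : ∃ A, A = Nat.card (F ≃g F) := ⟨_, rfl⟩
  have hA0 : 0 < A := hA ▸ natCard_automorphisms_pos
  have hA0' : (0 : ℝ) < A := by exact_mod_cast hA0
  obtain ⟨τ, hτ, hmain⟩ := exists_vertex_or_good_pairs hr hnot χ₁ hχ hcard hA0'.le hε
  refine ⟨τ, hτ, fun n hn hτn q hq H hH => ?_⟩
  have : Nonempty (Fin n) := ⟨⟨0, by omega⟩⟩
  have hH' : (#{e : Fin n × Fin n | H.Adj e.1 e.2} : ℝ) =
      #{e : Fin n × Fin n | residueColouring hr0 n e.1 ≠ residueColouring hr0 n e.2} +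
        2 * (q : ℝ) := by
    have : #{e : Fin n × Fin n | H.Adj e.1 e.2} =
        #{e : Fin n × Fin n | residueColouring hr0 n e.1 ≠ residueColouring hr0 n e.2} +
          2 * q := by
      rw [← two_mul_turanEdges, ← two_mul_ncard_edgeSet, hH]
      ring
    exact_mod_cast this
  have hA1 : (∃ u v, u ≠ v ∧ residueColouring hr0 n u = residueColouring hr0 n v ∧
      (#(embeddings F (multipartitePlus (residueColouring hr0 n) u v)) : ℝ) ≤
        (critCount r n F * A : ℝ) + A) := by
    obtain ⟨u, v, huv, h, hle⟩ := exists_card_embeddings_le (F := F) hr0 hn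
    exact ⟨u, v, huv, h, by rw [hA]; exact_mod_cast hle⟩
  rcases hmain (card_residueColouring_eq hr0 n) (by rwa [Fintype.card_fin])
    (Nat.cast_nonneg q) (by rwa [Fintype.card_fin])
    (fun u v huv h => by rw [hA]; exact_mod_cast critCount_mul_le (F := F) hr0 huv h) hA1 hH' with
    ⟨x, hx⟩ | ⟨E, hE, hgood⟩
  · refine Or.inl ⟨x, ?_⟩
    rw [copyCountThrough_eq, ← hA, Nat.le_div_iff_mul_le hA0, mul_assoc]
    exact_mod_cast hx
  · refine Or.inr ⟨E.image fun e => s(e.1, e.2), ?_, ?_, ?_⟩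
    · intro e he
      rw [mem_coe, mem_image] at he
      obtain ⟨e, he, rfl⟩ := he
      exact (hgood e he).1
    · have h1 : #E ≤ 2 * #(E.image fun e => s(e.1, e.2)) := by
        refine card_le_mul_card_image _ _ fun s _ => ?_
        induction s with | _ x y
        refine (card_le_card (t := {(x, y), (y, x)}) fun e he => ?_).trans card_le_two
        simp only [mem_filter, Sym2.eq_iff] at he
        simp only [mem_insert, mem_singleton, Prod.ext_iff]
        exact he.2
      have h2 : (#E : ℝ) ≤ 2 * #(E.image fun e => s(e.1, e.2)) := by exact_mod_cast h1
      have h3 : 0 ≤ ε * q := by positivity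
      linarith
    · intro e he
      rw [mem_image] at he
      obtain ⟨e, he, rfl⟩ := he
      rw [copyCountOnEdge_eq, ← hA]
      refine le_natDiv_of_mul_add_le hA0 ?_
      rw [mul_assoc]
      exact (hgood e he).2

end Turan

end

/-- For `r ≥ 2`, `r`-critical `F` and `ε > 0`: for all large `n` and
`1 ≤ q < n^{1−ε}`, every `n`-vertex graph with `t_r(n) + q` edges has a vertex lying in at
least `q·c(n,F)` copies of `F`, or at least `(1−ε)q` edges each lying in at least
`(1−ε)·c(n,F)` copies of `F`. -/
theorem copies_distribution {α : Type} [Fintype α] (r : ℕ) (hr : 2 ≤ r)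
    (F : SimpleGraph α) (hF : IsCriticalGraph r F) (ε : ℝ) (hε : 0 < ε) :
    ∃ n₀ : ℕ, ∀ n : ℕ, n₀ < n → ∀ q : ℕ, 1 ≤ q → (q : ℝ) < (n : ℝ) ^ (1 - ε) →
      ∀ H : SimpleGraph (Fin n), H.edgeSet.ncard = turanEdges r n + q →
        (∃ x : Fin n, q * critCount r n F ≤ copyCountThrough F H x) ∨
        (∃ E : Finset (Sym2 (Fin n)), ↑E ⊆ H.edgeSet ∧
          (1 - ε) * (q : ℝ) ≤ (E.card : ℝ) ∧
          ∀ e ∈ E, (1 - ε) * (critCount r n F : ℝ) ≤ (copyCountOnEdge F H e : ℝ)) := by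
  obtain ⟨τ, hτ, hmain⟩ := exists_vertex_or_edges_of_le hr hF hε
  have h1 : ∀ᶠ n : ℕ in Filter.atTop, (n : ℝ) ^ (-ε) ≤ τ :=
    ((tendsto_rpow_neg_atTop hε).comp tendsto_natCast_atTop_atTop).eventually
      (eventually_le_nhds hτ)
  have h2 : ∀ᶠ n : ℕ in Filter.atTop, 1 ≤ τ * (n : ℝ) :=
    (tendsto_natCast_atTop_atTop.const_mul_atTop hτ).eventually_ge_atTop 1
  obtain ⟨n₀, hn₀⟩ := Filter.eventually_atTop.1
    (h1.and <| h2.and <| Filter.eventually_gt_atTop r)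
  refine ⟨n₀, fun n hn q _ hq H hH => ?_⟩
  obtain ⟨h3, h4, h5⟩ := hn₀ n hn.le
  refine hmain n h5 h4 q ?_ H hH
  have hn0 : (0 : ℝ) < n := by exact_mod_cast (by omega : 0 < n)
  rw [sub_eq_neg_add, Real.rpow_add hn0, Real.rpow_one] at hq
  exact hq.le.trans (by gcongr)
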